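/- arXiv:2307.16445 — 7 statements merged into one kernel-verified Lean document; each statement's English description precedes it below -/
import Mathlib

section
/- Let n ≥ 1 and 1 ≤ m ≤ n, let F be an n×n real matrix and H an m×n real matrix. Assume the pair (F, H) is observable and H has full row rank m. Then there exist an invertible matrix T ∈ ℝ^{n×n}, an invertible matrix T_u ∈ ℝ^{m×m}, and a matrix R ∈ ℝ^{n×m} such that every entry of T(F − RH)T⁻¹ and every entry of T_u H T⁻¹ belongs to {0, 1} (in particular both are integer matrices). -/
open Module Submodule

/-- If `N ≤ W` with `f N ≤ W` and `N` contains no nonzero `f`-invariant subspace, then `W` has a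
basis `B`, a subset `S` of which is a basis of `N` that `f` maps into `B`. -/
theorem exists_linearIndepOn_chain_basis {K V : Type*} [Field K] [AddCommGroup V] [Module K V]
    [FiniteDimensional K V] (f : V →ₗ[K] V) (W N : Submodule K V) (hNW : N ≤ W)
    (hf : N ≤ W.comap f) (hinv : ∀ L ≤ N, L ≤ L.comap f → L = ⊥) :
    ∃ B S : Set V, LinearIndepOn K id B ∧ span K B = W ∧ S ⊆ B ∧ span K S = N ∧
      Set.MapsTo f S B := by
  induction W using WellFoundedLT.induction generalizing N with
  | ind W ih =>
    rcases hNW.eq_or_lt with rfl | hlt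
    · obtain rfl := hinv N le_rfl hf
      exact ⟨∅, ∅, linearIndependent_empty K V, span_empty, subset_rfl, span_empty,
        Set.mapsTo_empty _ _⟩
    obtain ⟨B, S, hB, hBN, hSB, hS, hfS⟩ := ih N hlt (N ⊓ N.comap f) inf_le_left inf_le_right
      fun L hL => hinv L (hL.trans inf_le_left)
    have hdisj : Disjoint (span K S) (span K (B \ S)) := by
      rw [← Set.union_sdiff_cancel hSB, linearIndepOn_id_union_iff Set.disjoint_sdiff_right] at hB
      exact hB.2.2
    have hzero : ∀ x ∈ span K (B \ S), f x ∈ N → x = 0 := fun x hx hfx =>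
      disjoint_def.1 hdisj x
        (hS ▸ ⟨hBN ▸ span_mono Set.sdiff_subset hx, hfx⟩) hx
    have hunion : LinearIndepOn K id (B ∪ f '' (B \ S)) := by
      refine hB.id_union ((hB.mono Set.sdiff_subset).image ?_) ?_
      · exact disjoint_def.2 fun x hx hx0 => hzero x hx (by
          rw [LinearMap.mem_ker.1 hx0]; exact N.zero_mem)
      · rw [hBN, span_image, disjoint_def]
        rintro _ hy ⟨x, hx, rfl⟩
        rw [hzero x hx hy, map_zero]
    have hsub : B ∪ f '' (B \ S) ⊆ (W : Set V) := by
      have hBN' : B ⊆ (N : Set V) := hBN ▸ subset_span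
      refine Set.union_subset (hBN'.trans hNW) ?_
      rintro _ ⟨b, hb, rfl⟩
      exact hf (hBN' hb.1)
    have hext := hunion.subset_extend hsub
    refine ⟨hunion.extend hsub, B, hunion.linearIndepOn_extend hsub, ?_,
      Set.subset_union_left.trans hext, hBN, fun b hb => hext ?_⟩
    · rw [hunion.span_extend_eq_span, span_eq]
    · by_cases hbS : b ∈ S
      · exact Or.inl (hfS hbS)
      · exact Or.inr ⟨b, ⟨hb, hbS⟩, rfl⟩

theorem exists_basis_fin_range_eq {K V : Type*} [Field K] [AddCommGroup V] [Module K V]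
    [FiniteDimensional K V] {n : ℕ} (hn : finrank K V = n) {B : Set V}
    (hB : LinearIndepOn K id B) (hspan : span K B = ⊤) :
    ∃ b : Basis (Fin n) K V, Set.range b = B := by
  let b₀ : Basis B K V := Basis.mk hB (by simp [hspan])
  have : Fintype B := FiniteDimensional.fintypeBasisIndex b₀
  have hcard : Fintype.card B = n := by rw [← hn, finrank_eq_card_basis b₀]
  refine ⟨b₀.reindex (Fintype.equivFinOfCardEq hcard), ?_⟩
  rw [Basis.range_reindex]
  simp [b₀]

/-- For an observable pair `(f, h)` with `h` surjective, an output injection `r` and suitable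
bases make `f - r ∘ₗ h` and `h` send every basis vector to `0` or to a basis vector. -/
theorem exists_bases_of_observable {K V U : Type*} [Field K] [AddCommGroup V] [Module K V]
    [FiniteDimensional K V] [AddCommGroup U] [Module K U] [FiniteDimensional K U] {n m : ℕ}
    (hn : finrank K V = n) (hm : finrank K U = m) (f : V →ₗ[K] V) (h : V →ₗ[K] U)
    (hsurj : Function.Surjective h)
    (hinv : ∀ L ≤ LinearMap.ker h, L ≤ L.comap f → L = ⊥) :
    ∃ (b : Basis (Fin n) K V) (u : Basis (Fin m) K U) (r : U →ₗ[K] V),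
      (∀ j, (f - r ∘ₗ h) (b j) = 0 ∨ (f - r ∘ₗ h) (b j) ∈ Set.range b) ∧
      (∀ j, h (b j) = 0 ∨ h (b j) ∈ Set.range u) := by
  obtain ⟨B, S, hB, hspan, hSB, hS, hfS⟩ :=
    exists_linearIndepOn_chain_basis f ⊤ (LinearMap.ker h) le_top (by simp) hinv
  have hdisj : Disjoint (span K (B \ S)) (LinearMap.ker h) := by
    have hB' := hB
    rw [← Set.union_sdiff_cancel hSB, linearIndepOn_id_union_iff Set.disjoint_sdiff_right] at hB'
    exact hS ▸ hB'.2.2.symm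
  have hSker : ∀ x ∈ S, h x = 0 := fun x hx =>
    LinearMap.mem_ker.1 (hS ▸ subset_span hx)
  have hinj : Set.InjOn h (B \ S) :=
    (LinearMap.injOn_of_disjoint_ker le_rfl hdisj).mono subset_span
  have htop : span K (h '' (B \ S)) = ⊤ := by
    rw [span_image, eq_top_iff, ← LinearMap.range_eq_top.2 hsurj, ← Submodule.map_top, ← hspan,
      ← Set.union_sdiff_cancel hSB, span_union, Submodule.map_sup, hS]
    refine sup_le ?_ (by simp)
    rintro _ ⟨x, hx, rfl⟩
    rw [LinearMap.mem_ker.1 hx]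
    exact zero_mem _
  obtain ⟨b, hb⟩ := exists_basis_fin_range_eq hn hB hspan
  obtain ⟨u, hu⟩ := exists_basis_fin_range_eq hm ((hB.mono Set.sdiff_subset).image hdisj) htop
  have hpre : ∀ k, ∃ x ∈ B \ S, h x = u k := fun k => by
    have : u k ∈ h '' (B \ S) := hu ▸ Set.mem_range_self k
    exact this
  choose s hs hsu using hpre
  have hr : ∀ x ∈ B \ S, u.constr K (fun k => f (s k)) (h x) = f x := fun x hx => by
    obtain ⟨k, hk⟩ : h x ∈ Set.range u := hu ▸ Set.mem_image_of_mem h hx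
    rw [← hk, Basis.constr_basis, hinj (hs k) hx ((hsu k).trans hk)]
  refine ⟨b, u, u.constr K fun k => f (s k), fun j => ?_, fun j => ?_⟩ <;>
    have hj : b j ∈ B := hb ▸ Set.mem_range_self j
  all_goals by_cases hjS : b j ∈ S
  · exact Or.inr (by simpa [hSker _ hjS, hb] using hfS hjS)
  · exact Or.inl (by simp [hr _ ⟨hj, hjS⟩])
  · exact Or.inl (hSker _ hjS)
  · exact Or.inr (hu ▸ Set.mem_image_of_mem h ⟨hj, hjS⟩)

theorem Module.Basis.repr_eq_zero_or_one {K V ι : Type*} [Field K] [AddCommGroup V] [Module K V]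
    (b : Basis ι K V) {x : V} (hx : x = 0 ∨ x ∈ Set.range b) (i : ι) :
    b.repr x i = 0 ∨ b.repr x i = 1 := by
  classical
  rcases hx with rfl | ⟨j, rfl⟩
  · simp
  · rw [b.repr_self_apply]
    split_ifs <;> simp

theorem Matrix.mulVec_surjective_of_linearIndependent_row {K : Type*} [Field K] {m n : Type*}
    [Fintype m] [Fintype n] (H : Matrix m n K) (hH : LinearIndependent K H.row) :
    Function.Surjective H.mulVecLin := by
  rw [← LinearMap.range_eq_top]
  apply Submodule.eq_top_of_finrank_eq
  rw [← Matrix.rank, hH.rank_matrix, finrank_fintype_fun_eq_card]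

/-- If `(F, H)` is observable and `H` has full row rank `m`, then there
exist invertible `T`, invertible `T_u` and `R` such that every entry of
`T (F - R H) T⁻¹` and every entry of `T_u H T⁻¹` belongs to `{0, 1}`. -/
theorem stmt0 (n m : ℕ) (hn : 1 ≤ n) (hm : 1 ≤ m) (hmn : m ≤ n)
    (F : Matrix (Fin n) (Fin n) ℝ) (H : Matrix (Fin m) (Fin n) ℝ)
    (hobs : ∀ x : Fin n → ℝ,
      (∀ i : ℕ, i < n → H.mulVec ((F ^ i).mulVec x) = 0) → x = 0)
    (hrank : LinearIndependent ℝ (fun i : Fin m => H i)) :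
    ∃ (T : Matrix (Fin n) (Fin n) ℝ) (Tu : Matrix (Fin m) (Fin m) ℝ)
      (R : Matrix (Fin n) (Fin m) ℝ),
      IsUnit T ∧ IsUnit Tu ∧
      (∀ i j, (T * (F - R * H) * T⁻¹) i j = 0 ∨ (T * (F - R * H) * T⁻¹) i j = 1) ∧
      (∀ i j, (Tu * H * T⁻¹) i j = 0 ∨ (Tu * H * T⁻¹) i j = 1) := by
  have hinv : ∀ L ≤ LinearMap.ker (Matrix.toLin' H), L ≤ L.comap (Matrix.toLin' F) → L = ⊥ := by
    refine fun L hL hLF => (Submodule.eq_bot_iff L).2 fun x hx => hobs x fun i _ => hL ?_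
    have hmem (i : ℕ) : (F ^ i).mulVec x ∈ L := by
      induction i with
      | zero => simpa using hx
      | succ i ih =>
        rw [pow_succ', ← Matrix.mulVec_mulVec]
        exact hLF ih
    exact hmem i
  obtain ⟨b, u, r, hb, hu⟩ := exists_bases_of_observable (n := n) (m := m) (by simp) (by simp)
    (Matrix.toLin' F) (Matrix.toLin' H)
    (Matrix.mulVec_surjective_of_linearIndependent_row H hrank) hinv
  have hT : (b.toMatrix (Pi.basisFun ℝ (Fin n)))⁻¹ = (Pi.basisFun ℝ (Fin n)).toMatrix b :=
    Matrix.inv_eq_right_inv (Basis.toMatrix_mul_toMatrix_flip _ _)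
  refine ⟨b.toMatrix (Pi.basisFun ℝ (Fin n)), u.toMatrix (Pi.basisFun ℝ (Fin m)),
    LinearMap.toMatrix' r, ?_, ?_, fun i j => ?_, fun i j => ?_⟩
  · exact .of_mul_eq_one _ (Basis.toMatrix_mul_toMatrix_flip _ _)
  · exact .of_mul_eq_one _ (Basis.toMatrix_mul_toMatrix_flip _ _)
  · have hF : F - LinearMap.toMatrix' r * H = LinearMap.toMatrix (Pi.basisFun ℝ (Fin n))
        (Pi.basisFun ℝ (Fin n)) (Matrix.toLin' F - r ∘ₗ Matrix.toLin' H) := by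
      rw [LinearMap.toMatrix_eq_toMatrix', map_sub, LinearMap.toMatrix'_comp]
      simp
    rw [hT, hF, basis_toMatrix_mul_linearMap_toMatrix_mul_basis_toMatrix, LinearMap.toMatrix_apply]
    exact b.repr_eq_zero_or_one (hb j) i
  · have hH : H = LinearMap.toMatrix (Pi.basisFun ℝ (Fin n)) (Pi.basisFun ℝ (Fin m))
        (Matrix.toLin' H) := (LinearMap.toMatrix'_toLin' H).symm
    rw [hT, hH, basis_toMatrix_mul_linearMap_toMatrix_mul_basis_toMatrix, LinearMap.toMatrix_apply]
    exact u.repr_eq_zero_or_one (hu j) i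
end

section
/- Let n ≥ 1 and 1 ≤ m ≤ n, let F be an n×n real matrix and H an m×n real matrix. Assume the pair (F, H) is observable and H has full row rank m. Then there exist an invertible matrix T ∈ ℝ^{n×n}, an invertible matrix T_u ∈ ℝ^{m×m}, and a matrix R ∈ ℝ^{n×m} such that: (i) T_u H T⁻¹ equals the m×n block matrix [I_m 0] (its (i,j) entry is 1 if j = i and 0 otherwise); (ii) every entry of T(F − RH)T⁻¹ belongs to {0, 1}; and (iii) (T(F − RH)T⁻¹)ⁿ = 0, so that F − RH is nilpotent. -/
open Submodule in
/-- A basis of `ker p` together with lifts of a basis of `range p` is a basis of the domain. -/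
theorem exists_basis_sum_of_ker_of_range {K A B ι κ : Type*} [Field K] [AddCommGroup A]
    [Module K A] [AddCommGroup B] [Module K B] (p : A →ₗ[K] B) (u : ι → A) (t : κ → A)
    (hu : LinearIndependent K u) (hus : span K (Set.range u) = LinearMap.ker p)
    (ht : LinearIndependent K (p ∘ t))
    (hts : LinearMap.range p ≤ span K (Set.range (p ∘ t))) :
    ∃ b : Module.Basis (ι ⊕ κ) K A, ⇑b = Sum.elim u t := by
  have hli : LinearIndependent K (Sum.elim u t) := by
    refine hu.sum_type (ht.of_comp p) ?_
    rw [hus]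
    exact (Submodule.range_ker_disjoint ht).symm
  refine ⟨Module.Basis.mk hli ?_, Module.Basis.coe_mk _ _⟩
  intro x _
  have hx : p x ∈ (span K (Set.range t)).map p := by
    rw [map_span, ← Set.range_comp]
    exact hts ⟨x, rfl⟩
  obtain ⟨y, hy, hyx⟩ := hx
  rw [Set.Sum.elim_range, span_union, hus]
  rw [← sub_add_cancel x y]
  refine add_mem (mem_sup_left ?_) (mem_sup_right hy)
  simp [hyx]

theorem Module.Basis.span_range_coe {K A ι : Type*} [Field K] [AddCommGroup A] [Module K A]
    {S : Submodule K A} (c : Module.Basis ι K S) :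
    Submodule.span K (Set.range fun i => (c i : A)) = S := by
  have h := congrArg (Submodule.map S.subtype) c.span_eq
  rwa [Submodule.map_span, ← Set.range_comp, Submodule.map_top, Submodule.range_subtype] at h

theorem Module.Basis.linearIndependent_coe {K A ι : Type*} [Field K] [AddCommGroup A] [Module K A]
    {S : Submodule K A} (c : Module.Basis ι K S) : LinearIndependent K fun i => (c i : A) :=
  c.linearIndependent.map' S.subtype S.ker_subtype

/-- Brunovsky form of a controllable pair, with the operator only given modulo the input space
`W`: there is a basis extending one of `W` on which `f` acts, modulo `W`, by sending each vector
to zero or to a basis vector of larger height. -/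
theorem exists_brunovsky_basis {K : Type*} [Field K] (d : ℕ) :
    ∀ {V : Type*} [AddCommGroup V] [Module K V] [FiniteDimensional K V] (W : Submodule K V)
      (f : V →ₗ[K] V ⧸ W), Module.finrank K V = d →
      (∀ U : Submodule K V, W ≤ U → (∀ u ∈ U, f u ∈ U.map W.mkQ) → U = ⊤) →
      ∃ (κ μ : Type) (b : Module.Basis (κ ⊕ μ) K V) (h : κ ⊕ μ → ℕ),
        Submodule.span K (Set.range (b ∘ Sum.inl)) = W ∧
        ∀ i, f (b i) = 0 ∨ ∃ j, h i < h j ∧ f (b i) = W.mkQ (b j) := by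
  induction d using Nat.strong_induction_on with
  | _ d ih =>
  intro V _ _ _ W f hd hgen
  by_cases hW : W = ⊥
  · subst hW
    have htop : (⊥ : Submodule K V) = ⊤ := hgen ⊥ le_rfl fun u hu => by
      rw [(Submodule.mem_bot K).1 hu, map_zero]
      exact zero_mem _
    have : Subsingleton V := (Submodule.subsingleton_iff K).1 (subsingleton_of_bot_eq_top htop)
    exact ⟨Empty, Empty, Module.Basis.empty V, fun _ => 0, Subsingleton.elim _ _,
      fun i => isEmptyElim i⟩
  let W₁ : Submodule K (V ⧸ W) := W.map f
  let f₁ : (V ⧸ W) →ₗ[K] (V ⧸ W) ⧸ W₁ := W.liftQ (W₁.mkQ ∘ₗ f) fun w hw => by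
    simpa using Submodule.mem_map_of_mem hw
  have hlt : Module.finrank K (V ⧸ W) < d := by
    have h₁ := W.finrank_quotient_add_finrank
    have h₂ : 0 < Module.finrank K W :=
      Nat.pos_of_ne_zero fun h => hW (Submodule.finrank_eq_zero.1 h)
    omega
  obtain ⟨κ, μ, b, h, hbW, hb⟩ := ih _ hlt W₁ f₁ rfl fun U hU hfU => by
    have htop := hgen (U.comap W.mkQ) (fun w hw => by
        simp [(Submodule.Quotient.mk_eq_zero W).2 hw]) fun u hu => by
      obtain ⟨y, hy, hyu⟩ := hfU (W.mkQ u) hu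
      rw [Submodule.map_comap_eq_of_surjective W.mkQ_surjective]
      have hmem : y - f u ∈ W₁ := (Submodule.Quotient.eq W₁).1 hyu
      simpa using sub_mem hy (hU hmem)
    rw [eq_top_iff]
    rintro ⟨v⟩ -
    exact (htop ▸ Submodule.mem_top : v ∈ U.comap W.mkQ)
  have hlift : ∀ i, ∃ t, W.mkQ t = b i ∧ (f t = 0 ∨ ∃ j, h i < h j ∧ f t = b j) := by
    intro i
    obtain ⟨v, hv⟩ := W.mkQ_surjective (b i)
    have hfv : f₁ (b i) = W₁.mkQ (f v) := by rw [← hv]; rfl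
    have key : ∀ y, W₁.mkQ (f v) = W₁.mkQ y → ∃ t, W.mkQ t = b i ∧ f t = y := by
      intro y hy
      obtain ⟨w, hw, hwy⟩ := (Submodule.Quotient.eq W₁).1 hy
      refine ⟨v - w, ?_, by rw [map_sub, hwy, sub_sub_cancel]⟩
      rw [map_sub, hv]
      simpa using hw
    rcases hb i with h0 | ⟨j, hj, hij⟩
    · obtain ⟨t, ht, hft⟩ := key 0 (by rw [← hfv, h0, map_zero])
      exact ⟨t, ht, Or.inl hft⟩
    · obtain ⟨t, ht, hft⟩ := key (b j) (hfv.symm.trans hij)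
      exact ⟨t, ht, Or.inr ⟨j, hj, hft⟩⟩
  choose t ht hft using hlift
  have hhead : ∀ k : κ, ∃ w : W, f w = b (Sum.inl k) := by
    intro k
    have hk : b (Sum.inl k) ∈ W₁ := hbW ▸ Submodule.subset_span ⟨k, rfl⟩
    obtain ⟨w, hw, hwk⟩ := hk
    exact ⟨⟨w, hw⟩, hwk⟩
  choose w hw using hhead
  let g : W →ₗ[K] V ⧸ W := f.domRestrict W
  let c := Module.finBasis K (LinearMap.ker g)
  have hgw : g ∘ w = b ∘ Sum.inl := funext hw
  obtain ⟨e, he⟩ := exists_basis_sum_of_ker_of_range g (fun i => (c i : W)) w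
    c.linearIndependent_coe
    c.span_range_coe
    (by rw [hgw]; exact b.linearIndependent.comp _ Sum.inl_injective)
    (by
      rw [hgw, hbW]
      rintro _ ⟨x, rfl⟩
      exact ⟨x, x.2, rfl⟩)
  have hspan : Submodule.span K (Set.range fun i => (e i : V)) = W :=
    e.span_range_coe
  have hmt : W.mkQ ∘ t = b := funext ht
  obtain ⟨B, hB⟩ := exists_basis_sum_of_ker_of_range W.mkQ (fun i => (e i : V)) t
    e.linearIndependent_coe
    (by rw [hspan, Submodule.ker_mkQ])
    (by rw [hmt]; exact b.linearIndependent)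
    (by rw [hmt, b.span_eq]; exact le_top)
  refine ⟨_, _, B, Sum.elim (fun _ => 0) (fun i => h i + 1), ?_, ?_⟩
  · rw [hB]
    exact hspan
  · rw [hB, he]
    rintro ((i | k) | i)
    · exact Or.inl (c i).2
    · exact Or.inr ⟨Sum.inr (Sum.inl k), by simp, (hw k).trans (ht _).symm⟩
    · rcases hft i with h0 | ⟨j, hj, hij⟩
      · exact Or.inl h0
      · exact Or.inr ⟨Sum.inr j, by simpa using hj, hij.trans (ht j).symm⟩

namespace Matrix

/-- A matrix whose nonzero entries strictly increase a height function is nilpotent. -/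
theorem pow_card_eq_zero_of_height {K ι : Type*} [Field K] [Fintype ι] [DecidableEq ι]
    (A : Matrix ι ι K) (h : ι → ℕ) (hA : ∀ i j, A i j ≠ 0 → h i < h j) :
    A ^ Fintype.card ι = 0 := by
  have hpow : ∀ k i j, (A ^ k) i j ≠ 0 → h i + k ≤ h j := by
    intro k
    induction k with
    | zero =>
      intro i j hij
      have : i = j := by
        by_contra hne
        exact hij (by simp [one_apply_ne hne])
      simp [this]
    | succ k ih =>
      intro i j hij
      rw [pow_succ, mul_apply] at hij
      obtain ⟨l, -, hl⟩ := Finset.exists_ne_zero_of_sum_ne_zero hij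
      have h₁ := ih i l (left_ne_zero_of_mul hl)
      have h₂ := hA l j (right_ne_zero_of_mul hl)
      omega
  have hnil : A ^ (∑ i, h i + 1) = 0 := by
    ext i j
    by_contra hne
    have h₁ := hpow _ i j hne
    have h₂ := Finset.single_le_sum (f := h) (fun _ _ => Nat.zero_le _) (Finset.mem_univ j)
    omega
  have hchar := (isNilpotent_charpoly_sub_pow_of_isNilpotent ⟨_, hnil⟩).eq_zero
  have haeval := A.aeval_self_charpoly
  rwa [sub_eq_zero.1 hchar, map_pow, Polynomial.aeval_X] at haeval

/-- For an observable pair, the only `F`-invariant space of row vectors containing the rows of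
`H` is the whole space. -/
theorem eq_top_of_observable {K : Type*} [Field K] {n m : ℕ} (F : Matrix (Fin n) (Fin n) K)
    (H : Matrix (Fin m) (Fin n) K)
    (hobs : ∀ x : Fin n → K, (∀ i : ℕ, i < n → H *ᵥ ((F ^ i) *ᵥ x) = 0) → x = 0)
    (U : Submodule K (Fin n → K)) (hHU : ∀ i, H i ∈ U) (hFU : ∀ u ∈ U, u ᵥ* F ∈ U) :
    U = ⊤ := by
  by_contra hne
  obtain ⟨φ, hφ, hφU⟩ := Submodule.exists_dual_map_eq_bot_of_lt_top (lt_top_iff_ne_top.2 hne)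
    inferInstance
  obtain ⟨x, rfl⟩ := (dotProductEquiv K (Fin n)).surjective φ
  have hpow : ∀ k, ∀ u ∈ U, u ᵥ* F ^ k ∈ U := by
    intro k
    induction k with
    | zero => simp
    | succ k ih =>
      intro u hu
      rw [pow_succ, ← vecMul_vecMul]
      exact hFU _ (ih u hu)
  have hx : x = 0 := hobs x fun k _ => by
    ext i
    have hmem := Submodule.mem_map_of_mem (f := dotProductEquiv K (Fin n) x) (hpow k _ (hHU i))
    erw [hφU, Submodule.mem_bot] at hmem
    rw [dotProductEquiv_apply_apply, dotProduct_comm, ← dotProduct_mulVec] at hmem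
    exact hmem
  exact hφ (by simp [hx])

end Matrix

/-- If `(F, H)` is observable and `H` has full row rank `m`, then there
exist invertible `T`, invertible `T_u` and `R` such that `T_u H T⁻¹ = [I_m 0]`, every
entry of `T (F - R H) T⁻¹` belongs to `{0, 1}`, and `(T (F - R H) T⁻¹)ⁿ = 0`. -/
theorem stmt1 (n m : ℕ) (hn : 1 ≤ n) (hm : 1 ≤ m) (hmn : m ≤ n)
    (F : Matrix (Fin n) (Fin n) ℝ) (H : Matrix (Fin m) (Fin n) ℝ)
    (hobs : ∀ x : Fin n → ℝ,
      (∀ i : ℕ, i < n → H.mulVec ((F ^ i).mulVec x) = 0) → x = 0)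
    (hrank : LinearIndependent ℝ (fun i : Fin m => H i)) :
    ∃ (T : Matrix (Fin n) (Fin n) ℝ) (Tu : Matrix (Fin m) (Fin m) ℝ)
      (R : Matrix (Fin n) (Fin m) ℝ),
      IsUnit T ∧ IsUnit Tu ∧
      (∀ (i : Fin m) (j : Fin n),
        (Tu * H * T⁻¹) i j = if (j : ℕ) = (i : ℕ) then 1 else 0) ∧
      (∀ i j, (T * (F - R * H) * T⁻¹) i j = 0 ∨ (T * (F - R * H) * T⁻¹) i j = 1) ∧
      (T * (F - R * H) * T⁻¹) ^ n = 0 := by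
  let W : Submodule ℝ (Fin n → ℝ) := Submodule.span ℝ (Set.range H.row)
  have hHW : ∀ i, H i ∈ W := fun i => Submodule.subset_span ⟨i, rfl⟩
  have hW : ∀ v ∈ W, ∃ c : Fin m → ℝ, Matrix.vecMul c H = v := by
    intro v hv
    exact (range_vecMulLinear H).ge hv
  obtain ⟨κ, μ, b, h, hbW, hb⟩ := exists_brunovsky_basis n W (W.mkQ ∘ₗ F.vecMulLinear) (by simp)
    fun U hWU hfU => Matrix.eq_top_of_observable F H hobs U (fun i => hWU (hHW i))
      fun u hu => by
        obtain ⟨y, hy, hyu⟩ := hfU u hu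
        have hmem := hWU ((Submodule.Quotient.eq W).1 hyu)
        simpa using sub_mem hy hmem
  have : Finite (κ ⊕ μ) := Module.Finite.finite_basis b
  have : Finite κ := Finite.sum_left μ
  have : Finite μ := Finite.sum_right κ
  have hbli : LinearIndependent ℝ (b ∘ Sum.inl) := b.linearIndependent.comp _ Sum.inl_injective
  have : Fintype κ := Fintype.ofFinite κ
  have : Fintype μ := Fintype.ofFinite μ
  have hκ : Fintype.card κ = m := by
    rw [← finrank_span_eq_card hbli, hbW]
    exact (finrank_span_eq_card hrank).trans (Fintype.card_fin m)
  have hμ : Fintype.card κ + Fintype.card μ = n := by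
    rw [← Fintype.card_sum, ← Module.finrank_eq_card_basis b]
    simp
  let eκ : κ ≃ Fin m := Fintype.equivFinOfCardEq hκ
  let eμ : μ ≃ Fin (n - m) := Fintype.equivFinOfCardEq (by omega)
  let e : κ ⊕ μ ≃ Fin n :=
    ((eκ.sumCongr eμ).trans finSumFinEquiv).trans (finCongr (Nat.add_sub_cancel' hmn))
  have he : ∀ i : Fin m, e.symm (Fin.castLE hmn i) = Sum.inl (eκ.symm i) := by
    intro i
    rw [Equiv.symm_apply_eq]
    ext
    simp [e]
  let T : Matrix (Fin n) (Fin n) ℝ := Matrix.of fun i => b (e.symm i)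
  have hT : IsUnit T := Matrix.linearIndependent_rows_iff_isUnit.1
    (b.linearIndependent.comp _ e.symm.injective)
  have hTdet : IsUnit T.det := (Matrix.isUnit_iff_isUnit_det T).1 hT
  have hTu : ∀ i : Fin m, ∃ c : Fin m → ℝ, Matrix.vecMul c H = b (Sum.inl (eκ.symm i)) :=
    fun i => hW _ (hbW ▸ Submodule.subset_span ⟨_, rfl⟩)
  choose Tu hTu using hTu
  have hA : ∀ i : Fin n, ∃ (a : Fin n → ℝ) (c : Fin m → ℝ),
      (∀ j, a j = 0 ∨ a j = 1 ∧ h (e.symm i) < h (e.symm j)) ∧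
        Matrix.vecMul (T i) F = Matrix.vecMul a T + Matrix.vecMul c H := by
    intro i
    rcases hb (e.symm i) with h0 | ⟨j, hj, hij⟩
    · obtain ⟨c, hc⟩ := hW _ ((Submodule.Quotient.mk_eq_zero W).1 h0)
      exact ⟨0, c, fun _ => Or.inl rfl, by rw [hc, Matrix.zero_vecMul, zero_add]; rfl⟩
    · obtain ⟨c, hc⟩ := hW _ ((Submodule.Quotient.eq W).1 hij)
      refine ⟨Pi.single (e j) 1, c, fun l => ?_, ?_⟩
      · by_cases hl : l = e j
        · subst hl
          exact Or.inr ⟨by simp, by simpa using hj⟩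
        · exact Or.inl (Pi.single_eq_of_ne hl _)
      · have hrow : T.row (e j) = b j := by
          ext l
          simp [T, Matrix.row]
        rw [hc, Matrix.single_one_vecMul, hrow, add_sub_cancel]
        rfl
  choose A C hA hAC using hA
  have hTF : T * F = Matrix.of A * T + Matrix.of C * H := Matrix.ext fun i j => congrFun (hAC i) j
  have hconj : T * (F - T⁻¹ * Matrix.of C * H) * T⁻¹ = Matrix.of A := by
    rw [Matrix.mul_sub, hTF, Matrix.mul_assoc T⁻¹, Matrix.mul_nonsing_inv_cancel_left _ _ hTdet,
      add_sub_cancel_right, Matrix.mul_nonsing_inv_cancel_right _ _ hTdet]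
  refine ⟨T, Matrix.of Tu, T⁻¹ * Matrix.of C, hT, ?_, ?_, ?_, ?_⟩
  · refine Matrix.linearIndependent_rows_iff_isUnit.1 (LinearIndependent.of_comp H.vecMulLinear ?_)
    have hcomp : H.vecMulLinear ∘ (Matrix.of Tu).row = (b ∘ Sum.inl) ∘ eκ.symm := funext hTu
    rw [hcomp]
    exact hbli.comp _ eκ.symm.injective
  · intro i j
    have hrow : (Matrix.of Tu * H).row i = T.row (Fin.castLE hmn i) :=
      (hTu i).trans (congrArg b (he i)).symm
    have hentry : (Matrix.of Tu * H * T⁻¹) i j = (T * T⁻¹) (Fin.castLE hmn i) j := by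
      simp only [Matrix.mul_apply (N := T⁻¹)]
      exact Finset.sum_congr rfl fun l _ => congrArg (· * T⁻¹ l j) (congrFun hrow l)
    rw [hentry, Matrix.mul_nonsing_inv _ hTdet, Matrix.one_apply]
    simp [Fin.ext_iff, eq_comm]
  · intro i j
    rw [hconj]
    exact (hA i j).imp_right And.left
  · rw [hconj]
    have hnil := Matrix.pow_card_eq_zero_of_height (Matrix.of A) (fun i => h (e.symm i))
      fun i j hij => ((hA i j).resolve_left hij).2
    rwa [Fintype.card_fin] at hnil
end

section
/- Let n ≥ 1 and 1 ≤ m ≤ n, let F be an n×n matrix and H an m×n matrix, both with rational entries. Assume the pair (F, H) is observable and H has full row rank m. Then there exist an invertible matrix T ∈ ℚ^{n×n}, an invertible matrix T_u ∈ ℚ^{m×m}, and a matrix R ∈ ℚ^{n×m}, all with rational entries, such that every entry of T(F − RH)T⁻¹ and every entry of T_u H T⁻¹ belongs to {0, 1}. -/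
/-- If a linearly independent set `S` contains a spanning set of `D`, then the remaining vectors
of `S` span a submodule disjoint from `D`. -/
theorem LinearIndepOn.disjoint_span_sdiff {K V : Type*} [Field K] [AddCommGroup V] [Module K V]
    {S : Set V} {D : Submodule K V} (hS : LinearIndepOn K id S)
    (hD : Submodule.span K (S ∩ D) = D) : Disjoint (Submodule.span K (S \ D)) D := by
  have h : LinearIndepOn K id (S \ D ∪ S ∩ D) := by rwa [Set.sdiff_union_inter]
  have h' := ((linearIndepOn_id_union_iff
    (Set.disjoint_left.2 fun x hx hx' => hx.2 hx'.2)).1 h).2.2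
  rwa [hD] at h'

/-- A shift basis: if `D ≤ E`, `f` maps `D` into `E`, and `D` contains no nonzero `f`-invariant
submodule, then `E` has a basis `S` adapted to `D` such that `f` maps `S ∩ D` into `S`. -/
theorem exists_adapted_basis_mapsTo {K V : Type*} [Field K] [AddCommGroup V] [Module K V]
    [FiniteDimensional K V] (f : V →ₗ[K] V) (D E : Submodule K V) (hDE : D ≤ E)
    (hf : D ≤ E.comap f) (hinv : ∀ W ≤ D, W ≤ W.comap f → W = ⊥) :
    ∃ S : Set V, LinearIndepOn K id S ∧ Submodule.span K S = E ∧
      Submodule.span K (S ∩ D) = D ∧ Set.MapsTo f (S ∩ D) S := by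
  induction hk : Module.finrank K E using Nat.strong_induction_on generalizing D E with
  | _ k ih =>
    rcases hDE.eq_or_lt with rfl | hlt
    · obtain rfl := hinv D le_rfl hf
      exact ⟨∅, linearIndepOn_empty K id, by simp, by simp, by simp⟩
    obtain ⟨S', hli, hspan, hspan', hmaps⟩ := ih _ (hk ▸ Submodule.finrank_lt_finrank_of_lt hlt)
      (D ⊓ D.comap f) D inf_le_left inf_le_right
      (fun W hW hWf => hinv W (hW.trans inf_le_left) hWf) rfl
    set D' := D ⊓ D.comap f
    have hS'D : S' ⊆ D := hspan ▸ Submodule.subset_span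
    have hdisj : Disjoint (Submodule.span K (S' \ D')) (D.mkQ ∘ₗ f).ker := by
      rw [Submodule.disjoint_def]
      intro x hx hxf
      have hxD : x ∈ D := hspan ▸ Submodule.span_mono Set.sdiff_subset hx
      exact Submodule.disjoint_def.1 (hli.disjoint_span_sdiff hspan') x hx
        ⟨hxD, by simpa using hxf⟩
    have hquot : LinearIndepOn K D.mkQ (f '' (S' \ D')) := by
      apply LinearIndepOn.image_of_comp
      refine LinearIndependent.map (f := D.mkQ ∘ₗ f) (hli.mono Set.sdiff_subset) ?_
      simpa only [id_eq, Subtype.range_coe] using hdisj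
    have hunion := LinearIndepOn.union_id_of_quotient hS'D hli hquot
    have hsub : S' ∪ f '' (S' \ D') ⊆ E := by
      rintro x (hx | ⟨y, hy, rfl⟩)
      · exact hDE (hS'D hx)
      · exact hf (hS'D hy.1)
    obtain ⟨S, hSE, hS'S, hES, hSli⟩ := exists_linearIndepOn_id_extension hunion hsub
    have hinter : S ∩ D = S' := by
      refine Set.Subset.antisymm (fun x hx => ?_)
        fun x hx => ⟨hS'S (Or.inl hx), hS'D hx⟩
      refine hli.mem_span_iff_id.1 (hspan ▸ hx.2) (hSli.mono ?_)
      exact Set.insert_subset hx.1 (Set.subset_union_left.trans hS'S)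
    refine ⟨S, hSli, le_antisymm (Submodule.span_le.2 hSE) hES, hinter ▸ hspan, ?_⟩
    rw [hinter]
    intro x hx
    by_cases hxD : x ∈ D'
    · exact hS'S (Or.inl (hmaps ⟨hx, hxD⟩))
    · exact hS'S (Or.inr ⟨x, ⟨hx, hxD⟩, rfl⟩)

/-- A matrix with linearly independent rows is surjective. -/
theorem Matrix.range_mulVecLin_eq_top_of_linearIndependent {K : Type*} [Field K] {m n : ℕ}
    {H : Matrix (Fin m) (Fin n) K} (h : LinearIndependent K H.row) :
    H.mulVecLin.range = ⊤ := by
  apply Submodule.eq_top_of_finrank_eq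
  simpa [Matrix.rank] using h.rank_matrix

/-- Rational version: if `(F, H)` over `ℚ` is observable and `H` has full
row rank `m`, then there exist rational invertible `T`, invertible `T_u` and `R` such that
every entry of `T (F - R H) T⁻¹` and of `T_u H T⁻¹` belongs to `{0, 1}`. -/
theorem stmt2 (n m : ℕ) (hn : 1 ≤ n) (hm : 1 ≤ m) (hmn : m ≤ n)
    (F : Matrix (Fin n) (Fin n) ℚ) (H : Matrix (Fin m) (Fin n) ℚ)
    (hobs : ∀ x : Fin n → ℚ,
      (∀ i : ℕ, i < n → H.mulVec ((F ^ i).mulVec x) = 0) → x = 0)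
    (hrank : LinearIndependent ℚ (fun i : Fin m => H i)) :
    ∃ (T : Matrix (Fin n) (Fin n) ℚ) (Tu : Matrix (Fin m) (Fin m) ℚ)
      (R : Matrix (Fin n) (Fin m) ℚ),
      IsUnit T ∧ IsUnit Tu ∧
      (∀ i j, (T * (F - R * H) * T⁻¹) i j = 0 ∨ (T * (F - R * H) * T⁻¹) i j = 1) ∧
      (∀ i j, (Tu * H * T⁻¹) i j = 0 ∨ (Tu * H * T⁻¹) i j = 1) := by
  classical
  have hinv : ∀ W ≤ H.mulVecLin.ker, W ≤ W.comap F.mulVecLin → W = ⊥ := by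
    intro W hW hWF
    rw [Submodule.eq_bot_iff]
    intro x hx
    have hpow : ∀ i : ℕ, (F ^ i).mulVec x ∈ W := by
      intro i
      induction i with
      | zero => simpa using hx
      | succ i ih =>
        rw [pow_succ', ← Matrix.mulVec_mulVec]
        exact hWF ih
    exact hobs x fun i _ => hW (hpow i)
  obtain ⟨S, hli, hspan, hker, hmaps⟩ :=
    exists_adapted_basis_mapsTo F.mulVecLin H.mulVecLin.ker ⊤ le_top (by simp) hinv
  set C := H.mulVecLin.ker
  let bS : Module.Basis S ℚ (Fin n → ℚ) := .mk hli (by simp [hspan])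
  have hbS : ∀ x : S, bS x = x := fun x => by simp [bS]
  let e : S ≃ Fin n := bS.indexEquiv (Pi.basisFun ℚ (Fin n))
  let b := bS.reindex e
  have hb : ∀ j, b j = (e.symm j : Fin n → ℚ) := fun j => by simp [b, hbS]
  have hcli : LinearIndependent ℚ (fun x : ↥(S \ C) => H.mulVecLin x) := by
    refine LinearIndependent.map (f := H.mulVecLin) (hli.mono Set.sdiff_subset) ?_
    simpa only [id_eq, Subtype.range_coe] using hli.disjoint_span_sdiff hker
  have hcspan : ⊤ ≤ Submodule.span ℚ (Set.range fun x : ↥(S \ C) => H.mulVecLin x) := by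
    rw [← Matrix.range_mulVecLin_eq_top_of_linearIndependent hrank, LinearMap.range_eq_map,
      ← hspan, Submodule.map_span_le]
    intro x hx
    by_cases hxC : x ∈ C
    · rw [LinearMap.mem_ker.1 hxC]
      exact zero_mem _
    · exact Submodule.subset_span ⟨⟨x, hx, hxC⟩, rfl⟩
  let cS : Module.Basis ↥(S \ C) ℚ (Fin m → ℚ) := .mk hcli hcspan
  have hcS : ∀ x : ↥(S \ C), cS x = H.mulVec x := fun x => by simp [cS]
  let c := cS.reindex (cS.indexEquiv (Pi.basisFun ℚ (Fin m)))
  have hcrepr : ∀ x : ↥(S \ C), ∀ i, c.equivFun (H.mulVec x) i = 0 ∨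
      c.equivFun (H.mulVec x) i = 1 := by
    intro x i
    rw [← hcS, Module.Basis.equivFun_apply, Module.Basis.repr_reindex_apply,
      Module.Basis.repr_self, Finsupp.single_apply]
    exact (ite_eq_or_eq _ _ _).symm
  let P : Matrix (Fin n) (Fin n) ℚ := Matrix.of fun i j => b j i
  have hP : ∀ (k : ℕ) (A : Matrix (Fin k) (Fin n) ℚ) i j, (A * P) i j = A.mulVec (b j) i :=
    fun _ _ _ _ => rfl
  let T := LinearMap.toMatrix' (b.equivFun : (Fin n → ℚ) →ₗ[ℚ] (Fin n → ℚ))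
  have hT : ∀ x, T.mulVec x = b.equivFun x := fun x => by simp [T]
  have hTP : T * P = 1 := by
    ext i j
    rw [hP, hT, Module.Basis.equivFun_self, Matrix.one_apply]
    simp [eq_comm]
  let Tu := LinearMap.toMatrix' (c.equivFun : (Fin m → ℚ) →ₗ[ℚ] (Fin m → ℚ))
  let Q := LinearMap.toMatrix' (c.equivFun.symm : (Fin m → ℚ) →ₗ[ℚ] (Fin m → ℚ))
  have hTu : ∀ x, Tu.mulVec x = c.equivFun x := fun x => by simp [Tu]
  have hTuQ : Tu * Q = 1 := by
    rw [← LinearMap.toMatrix'_comp]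
    simp
  let R := LinearMap.toMatrix' (cS.constr ℚ fun x => F.mulVec (x : Fin n → ℚ))
  have hR : ∀ x : ↥(S \ C), R.mulVec (H.mulVec x) = F.mulVec x := by
    intro x
    rw [LinearMap.toMatrix'_mulVec, ← hcS, Module.Basis.constr_basis]
  refine ⟨T, Tu, R, IsUnit.of_mul_eq_one _ hTP, IsUnit.of_mul_eq_one _ hTuQ, ?_, ?_⟩
  · intro i j
    rw [Matrix.inv_eq_right_inv hTP, hP, ← Matrix.mulVec_mulVec, hT, Matrix.sub_mulVec,
      ← Matrix.mulVec_mulVec, hb]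
    by_cases hj : (e.symm j : Fin n → ℚ) ∈ C
    · have hs := hmaps ⟨(e.symm j).2, hj⟩
      have hF : F.mulVec (e.symm j) = b (e ⟨_, hs⟩) := by simp [hb]
      rw [show H.mulVec (e.symm j) = 0 from hj, Matrix.mulVec_zero, sub_zero, hF,
        Module.Basis.equivFun_self]
      exact (ite_eq_or_eq _ _ _).symm
    · rw [hR ⟨_, (e.symm j).2, hj⟩]
      simp
  · intro i j
    rw [Matrix.inv_eq_right_inv hTP, hP, ← Matrix.mulVec_mulVec, hTu, hb]
    by_cases hj : (e.symm j : Fin n → ℚ) ∈ C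
    · rw [show H.mulVec (e.symm j) = 0 from hj]
      simp
    · exact hcrepr ⟨_, (e.symm j).2, hj⟩ i
end

section
/- Let n ≥ 1 and 1 ≤ m ≤ n, let F be an n×n real matrix and H an m×n real matrix, and let k ≥ 1 be an integer. Assume the pair (F, H) is observable and that k satisfies: for all λ₁, λ₂ ∈ ℂ that are roots of the characteristic polynomial of F (regarded as a polynomial over ℂ), if λ₁ ≠ λ₂ then λ₁^k ≠ λ₂^k. Then there exist an invertible matrix T ∈ ℝ^{n×n} and a matrix R ∈ ℝ^{n×m} such that every entry of T(F^k − RH)T⁻¹ is an integer. -/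
open Polynomial

theorem exists_X_sub_C_pow_dvd_sub_comp_X_pow {K : Type*} [Field K] [CharZero K] {k : ℕ}
    (hk : k ≠ 0) (u : K[X]) {a : K} (ha : a ≠ 0) (e : ℕ) :
    ∃ p : K[X], (X - C a) ^ e ∣ u - p.comp (X ^ k) := by
  obtain ⟨h, hh⟩ : X - C a ∣ X ^ k - C (a ^ k) := by
    rw [C_pow]; exact sub_dvd_pow_sub_pow _ _ _
  have hha : h.eval a ≠ 0 := by
    have hd := congrArg (fun q => (derivative q).eval a) hh
    simp only [derivative_sub, derivative_X_pow, derivative_C, derivative_mul, derivative_X] at hd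
    simp at hd
    rw [← hd]
    exact mul_ne_zero (Nat.cast_ne_zero.2 hk) (pow_ne_zero _ ha)
  induction e with
  | zero => exact ⟨0, by simp⟩
  | succ e ih =>
    obtain ⟨p, g, hg⟩ := ih
    refine ⟨p + C (g.eval a / h.eval a ^ e) * (X - C (a ^ k)) ^ e, ?_⟩
    have hsub : u - (p + C (g.eval a / h.eval a ^ e) * (X - C (a ^ k)) ^ e).comp (X ^ k) =
        (X - C a) ^ e * (g - C (g.eval a / h.eval a ^ e) * h ^ e) := by
      simp only [add_comp, mul_comp, C_comp, pow_comp, sub_comp, X_comp, hh]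
      rw [mul_sub, ← hg, mul_pow]; ring
    rw [hsub, pow_succ]
    refine mul_dvd_mul_left _ (dvd_iff_isRoot.2 ?_)
    simp [IsRoot, hha]

theorem exists_prod_X_sub_C_pow_dvd_sub_comp_X_pow {K : Type*} [Field K] [CharZero K]
    {k : ℕ} (hk : k ≠ 0) (s : Finset K) (hs : Set.InjOn (fun a => a ^ k) (s : Set K)) (e : ℕ)
    {u : K[X]} (hu : X ^ e ∣ u) :
    ∃ p : K[X], (∏ a ∈ s, (X - C a) ^ e) ∣ u - p.comp (X ^ k) := by
  have hloc : ∀ a : s, ∃ p : K[X], (X - C (a : K)) ^ e ∣ u - p.comp (X ^ k) := by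
    intro a
    by_cases ha : (a : K) = 0
    · exact ⟨0, by simpa [ha] using hu⟩
    · exact exists_X_sub_C_pow_dvd_sub_comp_X_pow hk u ha e
  choose q hq using hloc
  obtain ⟨p, hp⟩ := Ideal.exists_forall_sub_mem_ideal
    (I := fun a : s => Ideal.span {((X : K[X]) - C ((a : K) ^ k)) ^ e}) (by
      intro a b hab
      rw [Function.onFun, Ideal.isCoprime_span_singleton_iff]
      refine (isCoprime_X_sub_C_of_isUnit_sub ?_).pow
      refine (sub_ne_zero.2 fun h => hab (Subtype.ext (hs a.2 b.2 h))).isUnit) q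
  refine ⟨p, Finset.prod_dvd_of_coprime ?_ ?_⟩
  · intro a _ b _ hab
    exact (isCoprime_X_sub_C_of_isUnit_sub (sub_ne_zero.2 hab).isUnit).pow
  · intro a ha
    obtain ⟨g, hg⟩ := Ideal.mem_span_singleton.1 (hp ⟨a, ha⟩)
    have hpq : (X - C a) ^ e ∣ (p - q ⟨a, ha⟩).comp (X ^ k) := by
      rw [hg, mul_comp, pow_comp, sub_comp, X_comp, C_comp, C_pow]
      exact (pow_dvd_pow_of_dvd (sub_dvd_pow_sub_pow _ _ _) e).mul_right _
    have := dvd_sub (hq ⟨a, ha⟩) hpq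
    rwa [sub_comp, sub_sub_sub_cancel_right] at this

theorem Matrix.exists_pow_eq_sum_pow_pow {K : Type*} [Field K] [IsAlgClosed K] [CharZero K]
    {n k : ℕ} (hk : k ≠ 0) (M : Matrix (Fin n) (Fin n) K)
    (hM : ∀ a b : K, M.charpoly.IsRoot a → M.charpoly.IsRoot b → a ≠ b → a ^ k ≠ b ^ k) (l : ℕ) :
    ∃ c : ℕ → K, M ^ (k * n + l) = ∑ i ∈ Finset.range n, c i • (M ^ k) ^ i := by
  classical
  rcases Nat.eq_zero_or_pos n with rfl | hn
  · exact ⟨0, Subsingleton.elim _ _⟩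
  have hne : M.charpoly ≠ 0 := M.charpoly_monic.ne_zero
  obtain ⟨p, hp⟩ := exists_prod_X_sub_C_pow_dvd_sub_comp_X_pow hk M.charpoly.roots.toFinset (by
      intro a ha b hb hab
      by_contra hne'
      simp only [Finset.mem_coe, Multiset.mem_toFinset, mem_roots hne] at ha hb
      exact hM a b ha hb hne' hab) n (u := X ^ (k * n + l))
      (pow_dvd_pow _ (by nlinarith [Nat.pos_of_ne_zero hk]))
  have hdvd : M.charpoly ∣ ∏ a ∈ M.charpoly.roots.toFinset, (X - C a) ^ n := by
    conv_lhs => rw [(IsAlgClosed.splits M.charpoly).eq_prod_roots_of_monic M.charpoly_monic,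
      Finset.prod_multiset_map_count]
    refine Finset.prod_dvd_prod_of_dvd _ _ fun a _ => pow_dvd_pow _ ?_
    calc M.charpoly.roots.count a ≤ M.charpoly.roots.card := Multiset.count_le_card _ _
      _ ≤ M.charpoly.natDegree := card_roots' _
      _ = n := by simp [Matrix.charpoly_natDegree_eq_dim]
  obtain ⟨g, hg⟩ := hdvd.trans hp
  have hpow : M ^ (k * n + l) = aeval (M ^ k) p := by
    have := congrArg (aeval M) hg
    rw [map_mul, Matrix.aeval_self_charpoly, zero_mul, map_sub, sub_eq_zero, aeval_comp] at this
    simpa using this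
  have hroot : aeval (M ^ k) (M ^ k).charpoly = 0 := Matrix.aeval_self_charpoly _
  have hdeg : (p %ₘ (M ^ k).charpoly).natDegree < n := by
    have hd : (M ^ k).charpoly.natDegree = n := by simp [Matrix.charpoly_natDegree_eq_dim]
    conv_rhs => rw [← hd]
    refine natDegree_modByMonic_lt _ (Matrix.charpoly_monic _) fun h => ?_
    rw [h, natDegree_one] at hd
    omega
  exact ⟨_, by rw [hpow, ← aeval_modByMonic_eq_self_of_root hroot, aeval_eq_sum_range' hdeg]⟩

theorem Matrix.exists_real_pow_eq_sum_pow_pow {n k : ℕ} (hk : k ≠ 0)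
    (F : Matrix (Fin n) (Fin n) ℝ)
    (hF : ∀ a b : ℂ, (F.map Complex.ofReal).charpoly.IsRoot a →
      (F.map Complex.ofReal).charpoly.IsRoot b → a ≠ b → a ^ k ≠ b ^ k) (l : ℕ) :
    ∃ c : ℕ → ℝ, F ^ (k * n + l) = ∑ i ∈ Finset.range n, c i • (F ^ k) ^ i := by
  obtain ⟨c, hc⟩ := Matrix.exists_pow_eq_sum_pow_pow hk (F.map Complex.ofReal) hF l
  have hpow : ∀ (G : Matrix (Fin n) (Fin n) ℝ) (j : ℕ),
      (G.map Complex.ofReal) ^ j = (G ^ j).map Complex.ofReal := fun G j =>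
    (map_pow (RingHom.mapMatrix Complex.ofRealHom) G j).symm
  refine ⟨fun i => (c i).re, ?_⟩
  ext i j
  have h := congrArg (fun N : Matrix (Fin n) (Fin n) ℂ => (N i j).re) hc
  simp only [hpow, Matrix.sum_apply, Matrix.smul_apply, Matrix.map_apply,
    smul_eq_mul, Complex.re_sum, Complex.re_mul_ofReal, Complex.ofReal_re] at h ⊢
  exact h

theorem eq_top_of_observable_of_transpose_mem {K : Type*} [Field K] {n m : ℕ}
    {F : Matrix (Fin n) (Fin n) K} {H : Matrix (Fin m) (Fin n) K}
    (hobs : ∀ x : Fin n → K, (∀ i : ℕ, i < n → H.mulVec ((F ^ i).mulVec x) = 0) → x = 0)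
    {W : Submodule K (Fin n → K)}
    (hW : ∀ i < n, ∀ u, (F.transpose ^ i).mulVec (H.transpose.mulVec u) ∈ W) : W = ⊤ := by
  by_contra hne
  obtain ⟨f, hf, hker⟩ := W.exists_le_ker_of_lt_top (lt_top_iff_ne_top.2 hne)
  obtain ⟨x, rfl⟩ := (dotProductEquiv K (Fin n)).surjective f
  refine hf ?_
  rw [hobs x fun i hi => ?_, map_zero]
  refine dotProduct_eq_zero _ fun u => ?_
  have := hker (hW i hi u)
  simp only [LinearMap.mem_ker, dotProductEquiv_apply_apply] at this
  rw [← Matrix.transpose_pow, Matrix.mulVec_mulVec, ← Matrix.transpose_mul,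
    Matrix.mulVec_transpose, dotProduct_comm, ← Matrix.dotProduct_mulVec, ← Matrix.mulVec_mulVec,
    dotProduct_comm] at this
  exact this

/-- The vectors that `x ↦ A x + B u` can steer into `0` in `j` steps. -/
def nullControllable {K U V : Type*} [Field K] [AddCommGroup U] [Module K U] [AddCommGroup V]
    [Module K V] (A : Module.End K V) (B : U →ₗ[K] V) : ℕ → Submodule K V
  | 0 => ⊥
  | j + 1 => (nullControllable A B j ⊔ LinearMap.range B).comap A

section
variable {K U V : Type*} [Field K] [AddCommGroup U] [Module K U] [AddCommGroup V]
    [Module K V] (A : Module.End K V) (B : U →ₗ[K] V)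

theorem nullControllable_mono : Monotone (nullControllable A B) := by
  refine monotone_nat_of_le_succ fun j => ?_
  induction j with
  | zero => exact bot_le
  | succ j ih => exact Submodule.comap_mono (sup_le_sup_right ih _)

theorem mem_nullControllable_of_pow_apply_eq_sum (N : ℕ) (x : V) (u : ℕ → U)
    (h : (A ^ N) x = ∑ i ∈ Finset.range N, (A ^ i) (B (u i))) : x ∈ nullControllable A B N := by
  induction N generalizing x with
  | zero => simpa [nullControllable] using h
  | succ N ih =>
    have hmem := ih (A x - B (u N)) (by
      rw [map_sub, ← Module.End.mul_apply, ← pow_succ, h, Finset.sum_range_succ,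
        add_sub_cancel_right])
    exact Submodule.mem_sup.2 ⟨_, hmem, _, ⟨u N, rfl⟩, sub_add_cancel _ _⟩

theorem exists_feedback_sub_mem (W : Submodule K V) :
    ∃ κ : V →ₗ[K] U, ∀ x, A x ∈ W ⊔ LinearMap.range B → A x - B (κ x) ∈ W := by
  obtain ⟨s, hs⟩ := (W.mkQ ∘ₗ B).rangeRestrict.exists_rightInverse_of_surjective
    (LinearMap.range_rangeRestrict _)
  obtain ⟨t, ht⟩ := LinearMap.exists_extend s
  refine ⟨t ∘ₗ W.mkQ ∘ₗ A, fun x hx => ?_⟩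
  obtain ⟨w, hw, _, ⟨u, rfl⟩, hx⟩ := Submodule.mem_sup.1 hx
  have hmem : W.mkQ (A x) = W.mkQ (B u) := by
    rw [← hx, map_add, Submodule.mkQ_apply, (Submodule.Quotient.mk_eq_zero W).2 hw, zero_add]
  have hs' := congrArg Subtype.val (LinearMap.congr_fun hs ⟨W.mkQ (B u), ⟨u, rfl⟩⟩)
  have ht' := LinearMap.congr_fun ht ⟨W.mkQ (B u), ⟨u, rfl⟩⟩
  rw [← Submodule.Quotient.mk_eq_zero, ← Submodule.mkQ_apply, map_sub, sub_eq_zero]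
  simp only [LinearMap.comp_apply, Submodule.subtype_apply] at ht' hs' ⊢
  rw [hmem, ht']
  exact hs'.symm

theorem exists_feedback_map_nullControllable (N : ℕ) :
    ∃ κ : V →ₗ[K] U, ∀ j < N, ∀ x ∈ nullControllable A B (j + 1),
      (A - B ∘ₗ κ) x ∈ nullControllable A B j := by
  induction N with
  | zero => exact ⟨0, by simp⟩
  | succ N ih =>
    obtain ⟨κ₁, h₁⟩ := ih
    obtain ⟨κ₂, h₂⟩ := exists_feedback_sub_mem A B (nullControllable A B N)
    obtain ⟨C, hC⟩ := Submodule.exists_isCompl (nullControllable A B N)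
    let π := Submodule.projection _ C hC
    have hπ : ∀ x ∈ nullControllable A B N, π x = x := fun x hx =>
      Submodule.projection_apply_of_mem_left hC hx
    have hπ' : ∀ x, π x ∈ nullControllable A B N := fun x =>
      Submodule.projection_apply_mem hC x
    refine ⟨κ₁ ∘ₗ π + κ₂ ∘ₗ (LinearMap.id - π), fun j hj x hx => ?_⟩
    rcases Nat.lt_succ_iff_lt_or_eq.1 hj with hj | rfl
    · have := h₁ j hj x hx
      have hx' := hπ x (nullControllable_mono A B hj hx)
      simpa [hx'] using this
    · have hsplit : (A - B ∘ₗ (κ₁ ∘ₗ π + κ₂ ∘ₗ (LinearMap.id - π)) : Module.End K V) x =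
          (A - B ∘ₗ κ₁) (π x) + (A (x - π x) - B (κ₂ (x - π x))) := by
        simp; abel
      rw [hsplit]
      refine add_mem ?_ (h₂ _ ?_)
      · cases j with
        | zero =>
          have : π x = 0 := by simpa [nullControllable] using hπ' x
          simp [this]
        | succ j =>
          exact nullControllable_mono A B (Nat.le_succ j) (h₁ j (Nat.lt_succ_self j) _ (hπ' x))
      · exact sub_mem hx (nullControllable_mono A B (Nat.le_succ j) (hπ' x))

theorem exists_feedback_isNilpotent {N : ℕ} (h : nullControllable A B N = ⊤) :
    ∃ κ : V →ₗ[K] U, IsNilpotent (A - B ∘ₗ κ) := by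
  obtain ⟨κ, hκ⟩ := exists_feedback_map_nullControllable A B N
  have key : ∀ j ≤ N, ∀ x ∈ nullControllable A B j, ((A - B ∘ₗ κ) ^ j) x = 0 := by
    intro j
    induction j with
    | zero => intro _ x hx; simpa [nullControllable] using hx
    | succ j ih =>
      intro hj x hx
      rw [pow_succ, Module.End.mul_apply]
      exact ih (by omega) _ (hκ j (by omega) x hx)
  exact ⟨κ, N, LinearMap.ext fun x => key N le_rfl x (h ▸ Submodule.mem_top)⟩
end

theorem exists_basis_quotient_X_pow (K : Type*) [Field K] (e : ℕ) :
    ∃ b : Module.Basis (Fin e) K (K[X] ⧸ Submodule.span K[X] {(X : K[X]) ^ e}),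
      ∀ i, (X : K[X]) • b i = 0 ∨ ∃ j, (X : K[X]) • b i = b j := by
  have hmon : ((X : K[X]) ^ e).Monic := monic_X_pow e
  let p := AdjoinRoot.powerBasis' hmon
  have hp : p.dim = e := natDegree_X_pow e
  let b : Module.Basis (Fin e) K (K[X] ⧸ Submodule.span K[X] {(X : K[X]) ^ e}) :=
    p.basis.reindex (finCongr hp)
  have hb : ∀ i, b i = Submodule.Quotient.mk (X ^ (i : ℕ)) := fun i =>
    (p.basis.reindex_apply (finCongr hp) i).trans (p.basis_eq_pow _)
  refine ⟨b, fun i => ?_⟩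
  rw [hb, ← Submodule.Quotient.mk_smul, smul_eq_mul, ← pow_succ']
  by_cases h : (i : ℕ) + 1 < e
  · exact Or.inr ⟨⟨i + 1, h⟩, (hb ⟨i + 1, h⟩).symm⟩
  · left
    rw [Submodule.Quotient.mk_eq_zero, show (i : ℕ) + 1 = e by omega]
    exact Submodule.mem_span_singleton_self _

theorem exists_basis_of_isNilpotent {K V : Type*} [Field K] [AddCommGroup V] [Module K V]
    [Module.Finite K V] {f : Module.End K V} (hf : IsNilpotent f) :
    ∃ (d : ℕ) (e : Fin d → ℕ) (b : Module.Basis (Σ i, Fin (e i)) K V),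
      ∀ i, f (b i) = 0 ∨ ∃ j, f (b i) = b j := by
  classical
  obtain ⟨N, hN⟩ := hf
  have htors : Module.IsTorsion' (Module.AEval' f) (Submonoid.powers (X : K[X])) := by
    intro x
    obtain ⟨v, rfl⟩ := (Module.AEval'.of f).surjective x
    refine ⟨⟨X ^ N, N, rfl⟩, ?_⟩
    change (X ^ N : K[X]) • Module.AEval'.of f v = 0
    rw [Module.AEval'.X_pow_smul_of, hN, zero_smul, map_zero]
  obtain ⟨d, e, ⟨φ⟩⟩ := Module.torsion_by_prime_power_decomposition
    (R := K[X]) (p := X) irreducible_X htors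
  choose b hb using fun i => exists_basis_quotient_X_pow K (e i)
  let ψ := φ.trans (DirectSum.linearEquivFunOnFintype K[X] (Fin d) _)
  let c := ((Pi.basis b).map (ψ.restrictScalars K).symm).map (Module.AEval'.of f).symm
  have hc : ∀ i, c i = (Module.AEval'.of f).symm (ψ.symm (Pi.single i.1 (b i.1 i.2))) := by
    intro i
    simp [c]
  have hfc : ∀ i, f (c i) =
      (Module.AEval'.of f).symm (ψ.symm (Pi.single i.1 ((X : K[X]) • b i.1 i.2))) := by
    intro i
    rw [hc, Pi.single_smul, map_smul, Module.AEval'.of_symm_X_smul]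
  refine ⟨d, e, c, fun ⟨i, j⟩ => ?_⟩
  rcases hb i j with h | ⟨j', h⟩
  · left
    rw [hfc, h]; simp
  · right
    exact ⟨⟨i, j'⟩, by rw [hfc, hc, h]⟩

theorem Matrix.exists_conj_int_of_isNilpotent {K : Type*} [Field K] {n : ℕ}
    {M : Matrix (Fin n) (Fin n) K} (hM : IsNilpotent M) :
    ∃ T : Matrix (Fin n) (Fin n) K, IsUnit T ∧ ∀ i j, ∃ z : ℤ, (T * M * T⁻¹) i j = z := by
  classical
  obtain ⟨d, e, b, hb⟩ := exists_basis_of_isNilpotent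
    (hM.map (Matrix.toLinAlgEquiv' : Matrix (Fin n) (Fin n) K ≃ₐ[K] _))
  have hcard : Fintype.card (Σ i, Fin (e i)) = n := by
    rw [← Module.finrank_eq_card_basis b]; simp
  let c := b.reindex (Fintype.equivFinOfCardEq hcard)
  let s := Pi.basisFun K (Fin n)
  have h1 : c.toMatrix s * s.toMatrix c = 1 := c.toMatrix_mul_toMatrix_flip s
  have h2 : s.toMatrix c * c.toMatrix s = 1 := s.toMatrix_mul_toMatrix_flip c
  have hinv : (c.toMatrix s)⁻¹ = s.toMatrix c := Matrix.inv_eq_right_inv h1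
  refine ⟨c.toMatrix s, ⟨⟨_, _, h1, h2⟩, rfl⟩, fun i j => ?_⟩
  have hMs : M = LinearMap.toMatrix s s (Matrix.toLinAlgEquiv' M) := by
    ext i j
    simp [s]
  rw [hinv]
  nth_rewrite 1 [hMs]
  rw [basis_toMatrix_mul_linearMap_toMatrix_mul_basis_toMatrix, LinearMap.toMatrix_apply]
  have hcj : c j = b ((Fintype.equivFinOfCardEq hcard).symm j) := b.reindex_apply _ _
  rcases hb ((Fintype.equivFinOfCardEq hcard).symm j) with h | ⟨l, h⟩
  · exact ⟨0, by rw [hcj, h]; simp⟩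
  · have hl : b l = c (Fintype.equivFinOfCardEq hcard l) := by simp [c]
    refine ⟨if Fintype.equivFinOfCardEq hcard l = i then 1 else 0, ?_⟩
    rw [hcj, h, hl, c.repr_self, Finsupp.single_apply]
    split_ifs <;> simp

/-- If `(F, H)` is observable and `k ≥ 1` is such that distinct complex
eigenvalues of `F` remain distinct after taking `k`-th powers, then there exist an
invertible `T` and `R` such that every entry of `T (F^k - R H) T⁻¹` is an integer. -/
theorem stmt3 (n m : ℕ) (hn : 1 ≤ n) (hm : 1 ≤ m) (hmn : m ≤ n)
    (F : Matrix (Fin n) (Fin n) ℝ) (H : Matrix (Fin m) (Fin n) ℝ)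
    (k : ℕ) (hk : 1 ≤ k)
    (hobs : ∀ x : Fin n → ℝ,
      (∀ i : ℕ, i < n → H.mulVec ((F ^ i).mulVec x) = 0) → x = 0)
    (hdistinct : ∀ lam1 lam2 : ℂ,
      ((F.map (Complex.ofReal)).charpoly).IsRoot lam1 →
      ((F.map (Complex.ofReal)).charpoly).IsRoot lam2 →
      lam1 ≠ lam2 → lam1 ^ k ≠ lam2 ^ k) :
    ∃ (T : Matrix (Fin n) (Fin n) ℝ) (R : Matrix (Fin n) (Fin m) ℝ),
      IsUnit T ∧
      ∀ i j, ∃ z : ℤ, (T * (F ^ k - R * H) * T⁻¹) i j = (z : ℝ) := by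
  have hW : nullControllable (Matrix.toLin' (F ^ k).transpose) (Matrix.toLin' H.transpose) n =
      ⊤ := by
    refine eq_top_of_observable_of_transpose_mem hobs fun l _ u => ?_
    obtain ⟨c, hc⟩ := Matrix.exists_real_pow_eq_sum_pow_pow (by omega) F hdistinct l
    refine mem_nullControllable_of_pow_apply_eq_sum _ _ n _ (fun i => c i • u) ?_
    have hc' := congrArg
      (fun M : Matrix (Fin n) (Fin n) ℝ => M.transpose.mulVec (H.transpose.mulVec u)) hc
    simp only [Matrix.transpose_sum, Matrix.sum_mulVec, Matrix.transpose_smul,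
      Matrix.smul_mulVec, Matrix.transpose_pow] at hc'
    simp only [← Matrix.toLin'_pow, Matrix.toLin'_apply, Matrix.mulVec_smul,
      Matrix.transpose_pow]
    rw [← hc', Matrix.mulVec_mulVec, ← pow_mul, ← pow_add]
  obtain ⟨κ, hκ⟩ := exists_feedback_isNilpotent _ _ hW
  have hnil : IsNilpotent (F ^ k - (LinearMap.toMatrix' κ).transpose * H) := by
    have heq : Matrix.toLin' (F ^ k - (LinearMap.toMatrix' κ).transpose * H).transpose =
        Matrix.toLin' (F ^ k).transpose - Matrix.toLin' H.transpose ∘ₗ κ := by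
      rw [Matrix.transpose_sub, Matrix.transpose_mul, Matrix.transpose_transpose, map_sub,
        Matrix.toLin'_mul, Matrix.toLin'_toMatrix']
    rwa [← Matrix.isNilpotent_transpose_iff, ← Matrix.isNilpotent_toLin'_iff, heq]
  obtain ⟨T, hT, hTint⟩ := Matrix.exists_conj_int_of_isNilpotent hnil
  exact ⟨T, _, hT, hTint⟩
end

section
/- Let n ≥ 1 and 1 ≤ m ≤ n, let F be an n×n real matrix and H an m×n real matrix, and let k ≥ 1 be an integer. Assume the pair (F, H) is observable and that k satisfies: for all λ₁, λ₂ ∈ ℂ that are roots of the characteristic polynomial of F (regarded as a polynomial over ℂ), if λ₁ ≠ λ₂ then λ₁^k ≠ λ₂^k. Then there exist an invertible matrix T ∈ ℝ^{n×n} and a matrix R ∈ ℝ^{n×m} such that every entry of T(F^k − RH)T⁻¹ belongs to {0, 1} and (T(F^k − RH)T⁻¹)ⁿ = 0, i.e., F^k − RH is nilpotent. -/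
open Module Polynomial

theorem LinearMap.exists_eq_comp_of_ker_le {K V W Z : Type*} [Field K] [AddCommGroup V] [Module K V]
    [AddCommGroup W] [Module K W] [AddCommGroup Z] [Module K Z]
    (C : V →ₗ[K] W) (D : V →ₗ[K] Z) (h : ker C ≤ ker D) : ∃ R : W →ₗ[K] Z, D = R ∘ₗ C := by
  obtain ⟨R, hR⟩ := LinearMap.exists_extend
    ((ker C).liftQ D h ∘ₗ C.quotKerEquivRange.symm.toLinearMap)
  refine ⟨R, LinearMap.ext fun x => ?_⟩
  have hx := LinearMap.congr_fun hR (C.quotKerEquivRange ((ker C).mkQ x))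
  simpa using hx.symm

/-- A linear map that agrees with `B` on `Q` and with `A` on `W`, with values in `Q`. -/
theorem LinearMap.exists_eqOn_eqOn_of_map_le {K V : Type*} [Field K] [AddCommGroup V] [Module K V]
    (A B : End K V) (W Q : Submodule K V) (hA : ∀ x ∈ W, A x ∈ Q) (hB : ∀ x ∈ Q, B x ∈ Q)
    (h : ∀ x ∈ W, x ∈ Q → B x = A x) :
    ∃ E : End K V, (∀ x, E x ∈ Q) ∧ (∀ x ∈ Q, E x = B x) ∧ ∀ x ∈ W, E x = A x := by
  have hcomp : ∀ (x : (B.toPMap Q).domain) (y : (A.toPMap W).domain), (x : V) = y →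
      B.toPMap Q x = A.toPMap W y := by
    rintro ⟨x, hx⟩ ⟨y, hy⟩ rfl
    exact h x hy hx
  obtain ⟨g, hg⟩ := LinearMap.exists_extend ((B.toPMap Q).sup (A.toPMap W) hcomp).toFun
  obtain ⟨π, hπ⟩ := Q.subtype.exists_leftInverse_of_injective Q.ker_subtype
  have hπ' : ∀ x ∈ Q, (π x : V) = x := fun x hx =>
    congrArg Subtype.val (LinearMap.congr_fun hπ ⟨x, hx⟩)
  have hgB : ∀ x ∈ Q, g x = B x := fun x hx =>
    (LinearMap.congr_fun hg ⟨x, Submodule.mem_sup_left hx⟩).trans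
      (((B.toPMap Q).left_le_sup (A.toPMap W) hcomp).2 (x := ⟨x, hx⟩) rfl).symm
  have hgA : ∀ x ∈ W, g x = A x := fun x hx =>
    (LinearMap.congr_fun hg ⟨x, Submodule.mem_sup_right hx⟩).trans
      (((B.toPMap Q).right_le_sup (A.toPMap W) hcomp).2 (x := ⟨x, hx⟩) rfl).symm
  refine ⟨Q.subtype ∘ₗ π ∘ₗ g, fun x => (π (g x)).2, fun x hx => ?_, fun x hx => ?_⟩
  · simp [hgB x hx, hπ' _ (hB x hx)]
  · simp [hgA x hx, hπ' _ (hA x hx)]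

theorem Module.End.exists_invariant_pow_eq_zero_eqOn {K V : Type*} [Field K] [AddCommGroup V] [Module K V]
    [FiniteDimensional K V] (A : End K V) (P W : Submodule K V) (hWP : W ≤ P)
    (hA : ∀ x ∈ W, A x ∈ P)
    (h : ∀ N ≤ W, (∀ x ∈ N, A x ∈ N) → ∃ r : ℕ, ∀ x ∈ N, (A ^ r) x = 0) :
    ∃ B : End K V, (∀ x ∈ P, B x ∈ P) ∧ (∃ r : ℕ, ∀ x ∈ P, (B ^ r) x = 0) ∧
      ∀ x ∈ W, B x = A x := by
  induction hd : finrank K P using Nat.strong_induction_on generalizing P W with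
  | _ d ih =>
  subst hd
  rcases hWP.eq_or_lt with rfl | hlt
  · exact ⟨A, hA, h W le_rfl hA, fun _ _ => rfl⟩
  · have hQ : W.map A ≤ P := Submodule.map_le_iff_le_comap.2 hA
    have hAQ : ∀ x ∈ W, A x ∈ W.map A := fun x hx => Submodule.mem_map_of_mem hx
    obtain ⟨B, hBQ, ⟨r, hr⟩, hBA⟩ := ih _
      ((Submodule.finrank_map_le A W).trans_lt (Submodule.finrank_lt_finrank_of_lt hlt))
      (W.map A) (W ⊓ W.map A) inf_le_right (fun x hx => hAQ x hx.1)
      (fun N hN => h N (hN.trans inf_le_left)) rfl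
    obtain ⟨E, hE, hEB, hEA⟩ := LinearMap.exists_eqOn_eqOn_of_map_le A B W (W.map A) hAQ hBQ
      (fun x hx hx' => hBA x ⟨hx, hx'⟩)
    have hpow : ∀ s : ℕ, ∀ x ∈ W.map A, (E ^ s) x = (B ^ s) x := by
      intro s
      induction s with
      | zero => simp
      | succ s ihs =>
        intro x hx
        rw [pow_succ, pow_succ, Module.End.mul_apply, Module.End.mul_apply, hEB x hx,
          ihs _ (hBQ x hx)]
    refine ⟨E, fun x _ => hQ (hE x), ⟨r + 1, fun x _ => ?_⟩, hEA⟩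
    rw [pow_succ, Module.End.mul_apply, hpow r _ (hE x), hr _ (hE x)]

/-- If `A` is nilpotent on each `A`-invariant subspace of `W`, then the restriction of `A` to `W`
extends to a nilpotent endomorphism of the whole space. -/
theorem Module.End.exists_isNilpotent_eqOn {K V : Type*} [Field K] [AddCommGroup V] [Module K V]
    [FiniteDimensional K V] (A : End K V) (W : Submodule K V)
    (h : ∀ N ≤ W, (∀ x ∈ N, A x ∈ N) → ∃ r : ℕ, ∀ x ∈ N, (A ^ r) x = 0) :
    ∃ B : End K V, IsNilpotent B ∧ ∀ x ∈ W, B x = A x := by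
  obtain ⟨B, -, ⟨r, hr⟩, hBA⟩ := exists_invariant_pow_eq_zero_eqOn A ⊤ W le_top (fun _ _ => trivial) h
  exact ⟨B, ⟨r, LinearMap.ext fun x => hr x trivial⟩, hBA⟩

theorem DFinsupp.basis_apply_eq_single {K ι : Type*} [Field K] [DecidableEq ι] {M : ι → Type*}
    [∀ i, AddCommGroup (M i)] [∀ i, Module K (M i)] {η : ι → Type*}
    (b : ∀ i, Basis (η i) K (M i)) (i : ι) (j : η i) :
    DFinsupp.basis b ⟨i, j⟩ = DFinsupp.single i (b i j) := by
  classical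
  refine (DFinsupp.basis b).repr.injective (Finsupp.ext fun ⟨i', j'⟩ => ?_)
  rw [Basis.repr_self]
  change _ = (b i').repr (DFinsupp.single i (b i j) i') j'
  by_cases hi : i = i'
  · subst hi
    simp [Finsupp.single_apply]
  · simp [hi]

/-- A nilpotent endomorphism sends each vector of a suitable basis to zero or to a basis vector. -/
theorem Module.End.exists_basis_of_isNilpotent {K V : Type*} [Field K] [AddCommGroup V]
    [Module K V] [FiniteDimensional K V] (B : End K V) (hB : IsNilpotent B) :
    ∃ (ι : Type) (b : Basis ι K V), ∀ i, B (b i) = 0 ∨ ∃ j, B (b i) = b j := by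
  obtain ⟨r, hr⟩ := hB
  have htors : Module.IsTorsion' (AEval' B) (Submonoid.powers (X : K[X])) := by
    intro x
    refine ⟨⟨X ^ r, r, rfl⟩, ?_⟩
    obtain ⟨y, rfl⟩ := (AEval'.of B).surjective x
    change (X ^ r : K[X]) • AEval'.of B y = 0
    rw [AEval'.X_pow_smul_of, hr]; simp
  obtain ⟨d, e, ⟨φ⟩⟩ := Module.torsion_by_prime_power_decomposition (p := (X : K[X]))
    irreducible_X htors
  let bas : ∀ i : Fin d, Basis (Fin (X ^ e i : K[X]).natDegree) K
      (K[X] ⧸ K[X] ∙ (X ^ e i : K[X])) :=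
    fun i => AdjoinRoot.powerBasisAux' (monic_X_pow (e i))
  let ψ := AEval'.of B ≪≫ₗ φ.restrictScalars K
  let b := (DFinsupp.basis bas).map ψ.symm
  have hψ : ∀ v, ψ (B v) = (X : K[X]) • ψ v := by
    intro v
    change φ (AEval'.of B (B v)) = X • φ (AEval'.of B v)
    rw [← AEval'.X_smul_of, map_smul]
  have hbas : ∀ i j, bas i j = Submodule.Quotient.mk (X ^ (j : ℕ)) := fun i j =>
    (AdjoinRoot.powerBasis' (monic_X_pow (e i))).basis_eq_pow j
  have hb : ∀ i j, ψ (b ⟨i, j⟩) = DFinsupp.single i (Submodule.Quotient.mk (X ^ (j : ℕ))) := by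
    intro i j
    rw [Basis.map_apply, LinearEquiv.apply_symm_apply, ← hbas]
    exact DFinsupp.basis_apply_eq_single bas i j
  refine ⟨_, b, ?_⟩
  rintro ⟨i, j⟩
  have hX : ψ (B (b ⟨i, j⟩)) =
      DFinsupp.single i (Submodule.Quotient.mk (X ^ ((j : ℕ) + 1))) := by
    rw [hψ, hb]
    refine (DFinsupp.single_smul (X : K[X]) _).symm.trans ?_
    rw [← Submodule.Quotient.mk_smul, smul_eq_mul, pow_succ']
  by_cases hj : (j : ℕ) + 1 < (X ^ e i : K[X]).natDegree
  · refine Or.inr ⟨⟨i, ⟨j + 1, hj⟩⟩, ψ.injective ?_⟩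
    rw [hX, hb]
  · refine Or.inl (ψ.injective ?_)
    rw [hX, map_zero, (Submodule.Quotient.mk_eq_zero _).2]
    · exact DFinsupp.single_zero i
    · have hdeg := natDegree_X_pow (R := K) (e i)
      exact Submodule.mem_span_singleton.2 ⟨X ^ (j + 1 - e i : ℕ), by
        rw [smul_eq_mul, ← pow_add]; congr 1; omega⟩

theorem Module.End.exists_mem_spectrum_isRoot {V : Type*} [AddCommGroup V] [Module ℂ V]
    [FiniteDimensional ℂ V] (f : End ℂ V) (q : ℂ[X]) (hq : q ≠ 0) (y : V) (hy : y ≠ 0)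
    (h : aeval f q y = 0) : ∃ z ∈ spectrum ℂ f, q.eval z = 0 := by
  have : Nontrivial V := ⟨y, 0, hy⟩
  rcases Nat.eq_zero_or_pos q.natDegree with h0 | hpos
  · rw [eq_C_of_natDegree_eq_zero h0] at h hq
    simp only [aeval_C, Module.algebraMap_end_apply, smul_eq_zero, hy, or_false] at h
    simp [h] at hq
  · have hmem : (0 : ℂ) ∈ spectrum ℂ (aeval f q) := by
      rw [spectrum.zero_mem_iff, Module.End.isUnit_iff]
      exact fun hbij => hy (hbij.1 (by rw [h, map_zero]))
    rw [spectrum.map_polynomial_aeval_of_degree_pos _ _ (natDegree_pos_iff_degree_pos.1 hpos)]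
      at hmem
    exact hmem

/-- If `z ↦ z ^ k` is injective on the spectrum of `f`, then each eigenvector of `f ^ k` for a
nonzero eigenvalue is an eigenvector of `f`. -/
theorem Module.End.exists_apply_eq_smul_of_pow {V : Type*} [AddCommGroup V] [Module ℂ V]
    [FiniteDimensional ℂ V] (f : End ℂ V) (k : ℕ) (hk : 1 ≤ k)
    (hinj : Set.InjOn (fun z : ℂ => z ^ k) (spectrum ℂ f)) (μ : ℂ) (hμ : μ ≠ 0) (x : V)
    (hx : x ≠ 0) (h : (f ^ k) x = μ • x) : ∃ z : ℂ, f x = z • x := by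
  have hk0 : k ≠ 0 := by omega
  have hne : (X ^ k - C μ : ℂ[X]) ≠ 0 := X_pow_sub_C_ne_zero (by omega) μ
  obtain ⟨z, hz, hroot⟩ := exists_mem_spectrum_isRoot f (X ^ k - C μ) hne x hx (by simp [h])
  obtain ⟨q, hq⟩ := dvd_iff_isRoot.2 (show (X ^ k - C μ : ℂ[X]).IsRoot z from hroot)
  refine ⟨z, by_contra fun hy => ?_⟩
  obtain ⟨w, hw, hqw⟩ := exists_mem_spectrum_isRoot f q (right_ne_zero_of_mul (hq ▸ hne))
    (f x - z • x) (sub_ne_zero.2 hy) (by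
      have h1 : aeval f (q * (X - C z)) x = 0 := by
        rw [mul_comm, ← hq]; simp [h]
      simpa using h1)
  have hzk : z ^ k = μ := by simpa [sub_eq_zero] using hroot
  have hwk : w ^ k = μ := by
    have := congrArg (eval w) hq
    simpa [hqw, sub_eq_zero] using this
  obtain rfl : w = z := hinj hw hz (hwk.trans hzk.symm)
  have hder := congrArg (fun p => eval w (derivative p)) hq
  have hw0 : w ≠ 0 := by rintro rfl; exact hμ (by rw [← hzk, zero_pow hk0])
  simp [derivative_mul, hqw, derivative_X_pow, hw0, hk0] at hder

theorem Matrix.isNilpotent_of_forall_isRoot_charpoly {d : Type*} [Fintype d] [DecidableEq d]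
    (G : Matrix d d ℂ) (h : ∀ z, G.charpoly.IsRoot z → z = 0) : IsNilpotent G := by
  have hX : G.charpoly = X ^ Multiset.card G.charpoly.roots := by
    have := (IsAlgClosed.splits G.charpoly).eq_prod_roots_of_monic G.charpoly_monic
    rw [Multiset.eq_replicate_card.2 fun z hz => h z (isRoot_of_mem_roots hz)] at this
    simpa using this
  refine ⟨Multiset.card G.charpoly.roots, ?_⟩
  have := G.aeval_self_charpoly
  rwa [hX, map_pow, aeval_X] at this

theorem Matrix.re_map_ofReal_mulVec {a b : Type*} [Fintype b] (M : Matrix a b ℝ) (x : b → ℂ)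
    (i : a) : ((M.map Complex.ofReal).mulVec x i).re = M.mulVec (fun j => (x j).re) i := by
  simp [Matrix.mulVec, dotProduct]

theorem Matrix.im_map_ofReal_mulVec {a b : Type*} [Fintype b] (M : Matrix a b ℝ) (x : b → ℂ)
    (i : a) : ((M.map Complex.ofReal).mulVec x i).im = M.mulVec (fun j => (x j).im) i := by
  simp [Matrix.mulVec, dotProduct]

/-- A family of real matrices without common nonzero real kernel vector has no common nonzero
complex kernel vector. -/
theorem Matrix.eq_zero_of_forall_map_ofReal_mulVec {a b ι : Type*} [Fintype b]
    (M : ι → Matrix a b ℝ) (hM : ∀ x, (∀ i, (M i).mulVec x = 0) → x = 0)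
    (x : b → ℂ) (h : ∀ i, ((M i).map Complex.ofReal).mulVec x = 0) : x = 0 := by
  have hre : (fun j => (x j).re) = 0 := hM _ fun i => funext fun j => by
    rw [← re_map_ofReal_mulVec, h]; rfl
  have him : (fun j => (x j).im) = 0 := hM _ fun i => funext fun j => by
    rw [← im_map_ofReal_mulVec, h]; rfl
  exact funext fun j => Complex.ext (congrFun hre j) (congrFun him j)

theorem Matrix.map_ofReal_mul {a b c : Type*} [Fintype b] (M : Matrix a b ℝ) (N : Matrix b c ℝ) :
    (M * N).map Complex.ofReal = M.map Complex.ofReal * N.map Complex.ofReal :=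
  Matrix.map_mul (f := Complex.ofRealHom)

theorem Matrix.map_ofReal_pow {a : Type*} [Fintype a] [DecidableEq a] (M : Matrix a a ℝ) (i : ℕ) :
    (M ^ i).map Complex.ofReal = (M.map Complex.ofReal) ^ i :=
  Matrix.map_pow M Complex.ofRealHom i

/-- `H` annihilates no eigenvector of `F ^ k` for a nonzero complex eigenvalue. -/
theorem Matrix.eq_zero_of_pow_mulVec_eq_smul {n m : ℕ}
    (F : Matrix (Fin n) (Fin n) ℝ) (H : Matrix (Fin m) (Fin n) ℝ) (k : ℕ) (hk : 1 ≤ k)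
    (hobs : ∀ x : Fin n → ℝ,
      (∀ i : ℕ, i < n → H.mulVec ((F ^ i).mulVec x) = 0) → x = 0)
    (hdistinct : ∀ lam1 lam2 : ℂ,
      ((F.map (Complex.ofReal)).charpoly).IsRoot lam1 →
      ((F.map (Complex.ofReal)).charpoly).IsRoot lam2 →
      lam1 ≠ lam2 → lam1 ^ k ≠ lam2 ^ k)
    (x : Fin n → ℂ) (μ : ℂ) (hμ : μ ≠ 0)
    (hF : ((F ^ k).map Complex.ofReal).mulVec x = μ • x)
    (hH : (H.map Complex.ofReal).mulVec x = 0) : x = 0 := by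
  by_contra hx
  have hspec : ∀ z ∈ spectrum ℂ (Matrix.toLin' (F.map Complex.ofReal)),
      (F.map Complex.ofReal).charpoly.IsRoot z := fun z hz => by
    rwa [Module.End.mem_spectrum_iff_isRoot_charpoly, Matrix.charpoly_toLin'] at hz
  obtain ⟨z, hz⟩ := Module.End.exists_apply_eq_smul_of_pow (Matrix.toLin' (F.map Complex.ofReal))
    k hk (fun a ha b hb hab => by_contra fun hne =>
      hdistinct a b (hspec a ha) (hspec b hb) hne hab) μ hμ x hx (by
        rw [← Matrix.toLin'_pow, Matrix.toLin'_apply, ← map_ofReal_pow, hF])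
  rw [Matrix.toLin'_apply] at hz
  have hpow : ∀ i : ℕ, ((F.map Complex.ofReal) ^ i).mulVec x = z ^ i • x := by
    intro i
    induction i with
    | zero => simp
    | succ i ih => rw [pow_succ, ← Matrix.mulVec_mulVec, hz, Matrix.mulVec_smul, ih, smul_smul,
        pow_succ']
  refine hx (eq_zero_of_forall_map_ofReal_mulVec (fun i : Fin n => H * F ^ (i : ℕ))
    (fun y hy => hobs y fun i hi => by rw [Matrix.mulVec_mulVec]; exact hy ⟨i, hi⟩) x fun i => ?_)
  rw [map_ofReal_mul, map_ofReal_pow, ← Matrix.mulVec_mulVec, hpow, Matrix.mulVec_smul, hH,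
    smul_zero]

/-- A real matrix is nilpotent on an invariant subspace of `ker H` as soon as `H` annihilates no
eigenvector for a nonzero complex eigenvalue. -/
theorem Matrix.exists_pow_mulVec_eq_zero_of_invariant {n m : ℕ}
    (A : Matrix (Fin n) (Fin n) ℝ) (H : Matrix (Fin m) (Fin n) ℝ)
    (h : ∀ (x : Fin n → ℂ) (μ : ℂ), μ ≠ 0 → (A.map Complex.ofReal).mulVec x = μ • x →
      (H.map Complex.ofReal).mulVec x = 0 → x = 0)
    (N : Submodule ℝ (Fin n → ℝ)) (hN : ∀ x ∈ N, H.mulVec x = 0)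
    (hA : ∀ x ∈ N, A.toLin' x ∈ N) : ∃ r : ℕ, ∀ x ∈ N, (A.toLin' ^ r) x = 0 := by
  let f : End ℝ N := A.toLin'.restrict hA
  let c := Module.finBasis ℝ N
  let G := LinearMap.toMatrix c c f
  let P : Matrix (Fin n) (Fin (finrank ℝ N)) ℝ := LinearMap.toMatrix c (Pi.basisFun ℝ _) N.subtype
  have hPv : ∀ v, P.mulVec v = (c.equivFun.symm v : N) := by
    intro v
    have := LinearMap.toMatrix_mulVec_repr c (Pi.basisFun ℝ _) N.subtype (c.equivFun.symm v)
    rw [← Module.Basis.equivFun_apply, LinearEquiv.apply_symm_apply] at this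
    exact this
  have hAP : A * P = P * G := by
    have : A = LinearMap.toMatrix (Pi.basisFun ℝ _) (Pi.basisFun ℝ _) A.toLin' := by
      rw [LinearMap.toMatrix_eq_toMatrix', LinearMap.toMatrix'_toLin']
    rw [this, ← LinearMap.toMatrix_comp, ← LinearMap.toMatrix_comp]
    rfl
  have hHP : H * P = 0 := by
    refine Matrix.ext_of_mulVec_single fun i => ?_
    rw [← Matrix.mulVec_mulVec, hPv, hN _ (Subtype.property _), Matrix.zero_mulVec]
  have hG : IsNilpotent (G.map Complex.ofReal) := by
    refine isNilpotent_of_forall_isRoot_charpoly _ fun μ hμ => by_contra fun hμ0 => ?_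
    rw [← Matrix.charpoly_toLin', ← Module.End.hasEigenvalue_iff_isRoot_charpoly] at hμ
    obtain ⟨v, hv⟩ := hμ.exists_hasEigenvector
    have hv' := hv.apply_eq_smul
    rw [Matrix.toLin'_apply] at hv'
    have hPv0 := h ((P.map Complex.ofReal).mulVec v) μ hμ0
      (by rw [Matrix.mulVec_mulVec, ← map_ofReal_mul, hAP, map_ofReal_mul, ← Matrix.mulVec_mulVec,
        hv', Matrix.mulVec_smul])
      (by rw [Matrix.mulVec_mulVec, ← map_ofReal_mul, hHP]; simp)
    refine hv.2 (eq_zero_of_forall_map_ofReal_mulVec (fun _ : Unit => P) (fun y hy => ?_) v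
      fun _ => hPv0)
    have h0 : c.equivFun.symm y = 0 := Subtype.ext ((hPv y).symm.trans (hy ()))
    simpa only [map_eq_zero_iff _ c.equivFun.symm.injective] using h0
  obtain ⟨r, hr⟩ := hG
  have hGr : G ^ r = 0 := by
    refine Matrix.map_injective Complex.ofReal_injective ?_
    simp [map_ofReal_pow, hr]
  have hfr : f ^ r = 0 := by
    apply (LinearMap.toMatrix c c).injective
    rw [← LinearMap.toMatrix_pow, map_zero]
    exact hGr
  refine ⟨r, fun x hx => ?_⟩
  have := congrArg Subtype.val (LinearMap.congr_fun hfr ⟨x, hx⟩)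
  rwa [Module.End.pow_restrict] at this

theorem LinearMap.toMatrix_apply_eq_zero_or_one {K V ι : Type*} [Field K] [AddCommGroup V]
    [Module K V] [Fintype ι] [DecidableEq ι] (B : End K V) (b : Basis ι K V)
    (hb : ∀ i, B (b i) = 0 ∨ ∃ j, B (b i) = b j) (i j : ι) :
    LinearMap.toMatrix b b B i j = 0 ∨ LinearMap.toMatrix b b B i j = 1 := by
  rw [LinearMap.toMatrix_apply]
  rcases hb j with h | ⟨l, h⟩
  · simp [h]
  · rw [h, Basis.repr_self, Finsupp.single_apply]
    split_ifs <;> simp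

/-- If `(F, H)` is observable and `k ≥ 1` is such that distinct complex
eigenvalues of `F` remain distinct after taking `k`-th powers, then there exist an
invertible `T` and `R` such that every entry of `T (F^k - R H) T⁻¹` belongs to `{0, 1}`
and `(T (F^k - R H) T⁻¹)ⁿ = 0`, i.e., `F^k - R H` is nilpotent. -/
theorem stmt4 (n m : ℕ) (hn : 1 ≤ n) (hm : 1 ≤ m) (hmn : m ≤ n)
    (F : Matrix (Fin n) (Fin n) ℝ) (H : Matrix (Fin m) (Fin n) ℝ)
    (k : ℕ) (hk : 1 ≤ k)
    (hobs : ∀ x : Fin n → ℝ,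
      (∀ i : ℕ, i < n → H.mulVec ((F ^ i).mulVec x) = 0) → x = 0)
    (hdistinct : ∀ lam1 lam2 : ℂ,
      ((F.map (Complex.ofReal)).charpoly).IsRoot lam1 →
      ((F.map (Complex.ofReal)).charpoly).IsRoot lam2 →
      lam1 ≠ lam2 → lam1 ^ k ≠ lam2 ^ k) :
    ∃ (T : Matrix (Fin n) (Fin n) ℝ) (R : Matrix (Fin n) (Fin m) ℝ),
      IsUnit T ∧
      (∀ i j, (T * (F ^ k - R * H) * T⁻¹) i j = 0 ∨ (T * (F ^ k - R * H) * T⁻¹) i j = 1) ∧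
      (T * (F ^ k - R * H) * T⁻¹) ^ n = 0 := by
  obtain ⟨B, hB, hBA⟩ := Module.End.exists_isNilpotent_eqOn (F ^ k).toLin'
    (LinearMap.ker H.toLin') fun N hN hA =>
      Matrix.exists_pow_mulVec_eq_zero_of_invariant (F ^ k) H
        (Matrix.eq_zero_of_pow_mulVec_eq_smul F H k hk hobs hdistinct) N
        (fun x hx => hN hx) hA
  obtain ⟨R, hR⟩ := LinearMap.exists_eq_comp_of_ker_le H.toLin' ((F ^ k).toLin' - B)
    fun x hx => by simp [hBA x hx]
  have hBR : F ^ k - R.toMatrix' * H = B.toMatrix' := by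
    apply Matrix.toLin'.injective
    rw [map_sub, Matrix.toLin'_mul, Matrix.toLin'_toMatrix', Matrix.toLin'_toMatrix', ← hR]
    abel
  obtain ⟨ι, b₀, hb₀⟩ := Module.End.exists_basis_of_isNilpotent B hB
  let σ : ι ≃ Fin n := b₀.indexEquiv (Pi.basisFun ℝ (Fin n))
  let b := b₀.reindex σ
  have hb : ∀ i, B (b i) = 0 ∨ ∃ j, B (b i) = b j := by
    intro i
    rcases hb₀ (σ.symm i) with h | ⟨j, h⟩
    · exact Or.inl (by simpa [b] using h)
    · exact Or.inr ⟨σ j, by simpa [b] using h⟩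
  let e := Pi.basisFun ℝ (Fin n)
  have hinv : (b.toMatrix e)⁻¹ = e.toMatrix b :=
    Matrix.inv_eq_right_inv (Basis.toMatrix_mul_toMatrix_flip b e)
  have hconj : b.toMatrix e * (F ^ k - R.toMatrix' * H) * (b.toMatrix e)⁻¹ =
      LinearMap.toMatrix b b B := by
    rw [hBR, hinv, ← LinearMap.toMatrix_eq_toMatrix']
    exact basis_toMatrix_mul_linearMap_toMatrix_mul_basis_toMatrix _ _ _ _ _
  refine ⟨b.toMatrix e, R.toMatrix', ?_, ?_, ?_⟩
  · exact IsUnit.of_mul_eq_one _ (Basis.toMatrix_mul_toMatrix_flip b e)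
  · rw [hconj]
    exact LinearMap.toMatrix_apply_eq_zero_or_one B b hb
  · have hX := hB.charpoly_eq_X_pow_finrank
    have hBn := B.aeval_self_charpoly
    rw [hX, map_pow, aeval_X, finrank_fin_fun] at hBn
    rw [hconj, LinearMap.toMatrix_pow, hBn, map_zero]
end

section
/- Let q ≥ 1 and m ≥ 1, let F be an invertible q×q complex matrix and H an m×q complex matrix, and let k ≥ 1 be an integer. Assume: (i) for all λ₁, λ₂ ∈ ℂ that are eigenvalues of F, if λ₁ ≠ λ₂ then λ₁^k ≠ λ₂^k; and (ii) for every eigenvalue λ of F and every v ∈ ℂ^q with F v = λ v and H v = 0, one has v = 0. Then for every eigenvalue λ of F and every v ∈ ℂ^q with F^k v = λ^k v and H v = 0, one has v = 0. -/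
open Polynomial in
/-- If `a` lies in the spectrum of `x`, is nonzero, and is the only point `b` of the spectrum with
`b ^ k = a ^ k`, then `x ^ k - a ^ k` is a unit multiple of `x - a`. -/
theorem exists_isUnit_mul_sub_eq_pow_sub_pow {𝕜 A : Type*} [Field 𝕜] [CharZero 𝕜] [IsAlgClosed 𝕜]
    [Ring A] [Algebra 𝕜 A] {x : A} {a : 𝕜} {k : ℕ} (hk : k ≠ 0) (ha : a ≠ 0)
    (hmem : a ∈ spectrum 𝕜 x) (hinj : ∀ b ∈ spectrum 𝕜 x, b ^ k = a ^ k → b = a) :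
    ∃ u : A, IsUnit u ∧ u * (x - algebraMap 𝕜 A a) = x ^ k - algebraMap 𝕜 A (a ^ k) := by
  set p : 𝕜[X] := ∑ i ∈ Finset.range k, X ^ i * C a ^ (k - 1 - i) with hp
  have hfac : p * (X - C a) = X ^ k - C a ^ k := (Commute.all _ _).geom_sum₂_mul k
  refine ⟨aeval x p, ?_, by simpa using congrArg (aeval x) hfac⟩
  rw [← spectrum.zero_notMem_iff 𝕜, spectrum.map_polynomial_aeval_of_nonempty x p ⟨a, hmem⟩]
  rintro ⟨b, hb, hpb⟩
  have hpow : b ^ k = a ^ k := by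
    have h := congrArg (eval b) hfac
    simp only [eval_mul, hpb, zero_mul, eval_sub, eval_pow, eval_X, eval_C] at h
    exact sub_eq_zero.mp h.symm
  obtain rfl := hinj b hb hpow
  have hval : eval b p = k * b ^ (k - 1) := by
    simp only [hp, eval_finsetSum, eval_mul, eval_pow, eval_X, eval_C]
    exact geom_sum₂_self b k
  exact mul_ne_zero (Nat.cast_ne_zero.mpr hk) (pow_ne_zero _ ha) (hval.symm.trans hpb)

/-- Let `F` be invertible, suppose distinct eigenvalues of `F` remain
distinct after taking `k`-th powers, and suppose the eigenvector (PBH) observability test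
holds for `(F, H)`. Then for every eigenvalue `λ` of `F`, any `v` with `F^k v = λ^k v`
and `H v = 0` must be zero. -/
theorem stmt7 (q m : ℕ) (hq : 1 ≤ q) (hm : 1 ≤ m)
    (F : Matrix (Fin q) (Fin q) ℂ) (H : Matrix (Fin m) (Fin q) ℂ)
    (k : ℕ) (hk : 1 ≤ k)
    (hF : IsUnit F)
    (hdistinct : ∀ lam1 lam2 : ℂ,
      ¬ IsUnit (F - lam1 • (1 : Matrix (Fin q) (Fin q) ℂ)) →
      ¬ IsUnit (F - lam2 • (1 : Matrix (Fin q) (Fin q) ℂ)) →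
      lam1 ≠ lam2 → lam1 ^ k ≠ lam2 ^ k)
    (hpbh : ∀ lam : ℂ, ¬ IsUnit (F - lam • (1 : Matrix (Fin q) (Fin q) ℂ)) →
      ∀ v : Fin q → ℂ, F.mulVec v = lam • v → H.mulVec v = 0 → v = 0) :
    ∀ lam : ℂ, ¬ IsUnit (F - lam • (1 : Matrix (Fin q) (Fin q) ℂ)) →
      ∀ v : Fin q → ℂ, (F ^ k).mulVec v = lam ^ k • v → H.mulVec v = 0 → v = 0 := by
  have hspec : ∀ μ : ℂ, μ ∈ spectrum ℂ F ↔ ¬ IsUnit (F - μ • (1 : Matrix (Fin q) (Fin q) ℂ)) :=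
    fun μ => by rw [spectrum.mem_iff, ← IsUnit.neg_iff, neg_sub, Algebra.algebraMap_eq_smul_one]
  intro lam hlam v hv hHv
  have hlam0 : lam ≠ 0 := by
    rintro rfl
    exact hlam (by simpa using hF)
  obtain ⟨u, hu, hmul⟩ := exists_isUnit_mul_sub_eq_pow_sub_pow (Nat.one_le_iff_ne_zero.mp hk)
    hlam0 ((hspec lam).mpr hlam) fun μ hμ hpow =>
      not_imp_not.mp (hdistinct μ lam ((hspec μ).mp hμ) hlam) hpow
  refine hpbh lam hlam v ?_ hHv
  have huv : u.mulVec ((F - lam • (1 : Matrix (Fin q) (Fin q) ℂ)).mulVec v) = 0 := by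
    rw [Matrix.mulVec_mulVec, ← Algebra.algebraMap_eq_smul_one, hmul,
      Algebra.algebraMap_eq_smul_one, Matrix.sub_mulVec, Matrix.smul_mulVec, Matrix.one_mulVec,
      hv, sub_self]
  have hker := Matrix.mulVec_injective_of_isUnit hu (huv.trans (Matrix.mulVec_zero u).symm)
  rwa [Matrix.sub_mulVec, Matrix.smul_mulVec, Matrix.one_mulVec, sub_eq_zero] at hker
end

section
/- Let n ≥ 1, let F be an n×n real matrix and H an m×n real matrix, and define the subspaces U₀ := ℝⁿ and, for i ≥ 1, Uᵢ := {x ∈ ℝⁿ : H Fʲ x = 0 for all 0 ≤ j ≤ i−1}. Fix j with 1 ≤ j ≤ n−1, and let w₁ : ι₁ → ℝⁿ and w₂ : ι₂ → ℝⁿ be finite families of vectors such that: the combined family consisting of all vectors w₁(a) and w₂(b) is linearly independent; every vector w₂(b) belongs to U_{n−j}; the span of the vectors w₂(b) intersects U_{n−j+1} only in {0}; and every vector w₁(a) belongs to U_{n−j+1}. Then the combined family consisting of all vectors w₁(a), w₂(b), and F·w₂(b) is linearly independent, and every vector of this combined family belongs to U_{n−j−1}. -/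
/-- The unobservability subspaces: `U i = {x : H F^j x = 0 for all 0 ≤ j ≤ i−1}`
(so `U 0 = ℝⁿ`). -/
def unobsSubspace {n m : ℕ} (F : Matrix (Fin n) (Fin n) ℝ)
    (H : Matrix (Fin m) (Fin n) ℝ) (i : ℕ) : Submodule ℝ (Fin n → ℝ) where
  carrier := {x | ∀ j : ℕ, j < i → H.mulVec ((F ^ j).mulVec x) = 0}
  add_mem' := by
    intro a b ha hb j hj
    simp [Matrix.mulVec_add, ha j hj, hb j hj]
  zero_mem' := by
    intro j hj
    simp
  smul_mem' := by
    intro c a ha j hj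
    simp [Matrix.mulVec_smul, ha j hj]

lemma mem_unobsSubspace {n m : ℕ} {F : Matrix (Fin n) (Fin n) ℝ}
    {H : Matrix (Fin m) (Fin n) ℝ} {i : ℕ} {x : Fin n → ℝ} :
    x ∈ unobsSubspace F H i ↔ ∀ k < i, H.mulVec ((F ^ k).mulVec x) = 0 :=
  Iff.rfl

lemma unobsSubspace_antitone {n m : ℕ} (F : Matrix (Fin n) (Fin n) ℝ)
    (H : Matrix (Fin m) (Fin n) ℝ) : Antitone (unobsSubspace F H) :=
  fun _ _ hab _ hx k hk => hx k (hk.trans_le hab)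

lemma mem_unobsSubspace_succ {n m : ℕ} {F : Matrix (Fin n) (Fin n) ℝ}
    {H : Matrix (Fin m) (Fin n) ℝ} {i : ℕ} {x : Fin n → ℝ} :
    x ∈ unobsSubspace F H (i + 1) ↔
      H.mulVec x = 0 ∧ F.mulVec x ∈ unobsSubspace F H i := by
  simp only [mem_unobsSubspace, Nat.forall_lt_succ_left, pow_zero, Matrix.mulVec_mulVec,
    Matrix.mul_one, pow_succ]

/-- On `U i` with `i` positive, `x ∈ U (i + 1)` as soon as `F x ∈ U i`. -/
lemma mem_unobsSubspace_succ_of_mulVec_mem {n m : ℕ} {F : Matrix (Fin n) (Fin n) ℝ}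
    {H : Matrix (Fin m) (Fin n) ℝ} {i : ℕ} (hi : 0 < i) {x : Fin n → ℝ}
    (hx : x ∈ unobsSubspace F H i) (hFx : F.mulVec x ∈ unobsSubspace F H i) :
    x ∈ unobsSubspace F H (i + 1) :=
  mem_unobsSubspace_succ.2 ⟨by simpa using hx 0 hi, hFx⟩

/-- If the combined family `(w₁, w₂)` is linearly independent, all
`w₂ b ∈ U_{n−j}`, `span(w₂) ∩ U_{n−j+1} = {0}` and all `w₁ a ∈ U_{n−j+1}`, then the
combined family `(w₁, w₂, F·w₂)` is linearly independent and all its vectors lie in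
`U_{n−j−1}`. -/
theorem stmt8 (n m : ℕ) (hn : 1 ≤ n)
    (F : Matrix (Fin n) (Fin n) ℝ) (H : Matrix (Fin m) (Fin n) ℝ)
    (j : ℕ) (hj1 : 1 ≤ j) (hj2 : j ≤ n - 1)
    (ι₁ ι₂ : Type) [Fintype ι₁] [Fintype ι₂]
    (w₁ : ι₁ → Fin n → ℝ) (w₂ : ι₂ → Fin n → ℝ)
    (hli : LinearIndependent ℝ (Sum.elim w₁ w₂))
    (hw₂ : ∀ b, w₂ b ∈ unobsSubspace F H (n - j))
    (hint : Submodule.span ℝ (Set.range w₂) ⊓ unobsSubspace F H (n - j + 1) = ⊥)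
    (hw₁ : ∀ a, w₁ a ∈ unobsSubspace F H (n - j + 1)) :
    LinearIndependent ℝ (Sum.elim w₁ (Sum.elim w₂ (fun b => F.mulVec (w₂ b)))) ∧
    (∀ a, w₁ a ∈ unobsSubspace F H (n - j - 1)) ∧
    (∀ b, w₂ b ∈ unobsSubspace F H (n - j - 1)) ∧
    (∀ b, F.mulVec (w₂ b) ∈ unobsSubspace F H (n - j - 1)) := by
  obtain ⟨i, hi⟩ : ∃ i, n - j = i + 1 := ⟨n - j - 1, by omega⟩
  rw [hi] at hw₂ hint hw₁
  rw [hi, Nat.add_sub_cancel]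
  have hw₁' (a) : w₁ a ∈ unobsSubspace F H (i + 1) :=
    unobsSubspace_antitone F H (Nat.le_succ _) (hw₁ a)
  have hspan : Submodule.span ℝ (Set.range w₂) ≤ unobsSubspace F H (i + 1) :=
    Submodule.span_le.2 (Set.range_subset_iff.2 hw₂)
  have hspan_elim :
      Submodule.span ℝ (Set.range (Sum.elim w₁ w₂)) ≤ unobsSubspace F H (i + 1) :=
    Submodule.span_le.2 (Set.range_subset_iff.2 (Sum.rec hw₁' hw₂))
  have eq_zero_of_mulVec_mem {y : Fin n → ℝ} (hy : y ∈ Submodule.span ℝ (Set.range w₂))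
      (hFy : F.mulVec y ∈ unobsSubspace F H (i + 1)) : y = 0 :=
    (Submodule.mem_bot ℝ).1 <| hint ▸ Submodule.mem_inf.2
      ⟨hy, mem_unobsSubspace_succ_of_mulVec_mem i.succ_pos (hspan hy) hFy⟩
  have hFw₂ : LinearIndependent ℝ (F.mulVecLin ∘ w₂) := by
    refine (hli.comp Sum.inr Sum.inr_injective).map (Submodule.disjoint_def.2 ?_)
    intro y hy hFy
    refine eq_zero_of_mulVec_mem hy ?_
    rw [← Matrix.mulVecLin_apply, LinearMap.mem_ker.1 hFy]
    exact zero_mem _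
  have hdisj : Disjoint (Submodule.span ℝ (Set.range (Sum.elim w₁ w₂)))
      (Submodule.span ℝ (Set.range (F.mulVecLin ∘ w₂))) := by
    rw [Set.range_comp, Submodule.span_image, Submodule.disjoint_def]
    rintro _ hx ⟨y, hy, rfl⟩
    rw [eq_zero_of_mulVec_mem hy (hspan_elim hx), map_zero]
  refine ⟨?_, fun a => unobsSubspace_antitone F H (Nat.le_succ _) (hw₁' a),
    fun b => unobsSubspace_antitone F H (Nat.le_succ _) (hw₂ b),
    fun b => (mem_unobsSubspace_succ.1 (hw₂ b)).2⟩
  have hcomp : Sum.elim w₁ (Sum.elim w₂ (fun b => F.mulVec (w₂ b))) ∘ Equiv.sumAssoc ι₁ ι₂ ι₂ =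
      Sum.elim (Sum.elim w₁ w₂) (F.mulVecLin ∘ w₂) := by
    ext ((a | b) | b) <;> rfl
  rw [← linearIndependent_equiv (Equiv.sumAssoc ι₁ ι₂ ι₂), hcomp]
  exact hli.sum_type hFw₂ hdisj
end
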